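/- Let K be a finite geometric simplicial complex of dimension m ≥ 3. If there exists a continuous map f : |K| → ℝ^{2m} without 2-Tverberg points (an almost-embedding), then there exists a topological embedding of |K| into ℝ^{2m}, i.e., a continuous injective map g : |K| → ℝ^{2m}. -/

import Mathlib

open Set

noncomputable section

/-- `s` is a face of `K` containing `x` in its relative interior; i.e. `s` is the
support of `x` in `K`. -/
def IsSupportFace {n : ℕ} (K : Geometry.SimplicialComplex ℝ (EuclideanSpace ℝ (Fin n)))
    (x : EuclideanSpace ℝ (Fin n)) (s : Finset (EuclideanSpace ℝ (Fin n))) : Prop :=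
  s ∈ K.faces ∧ x ∈ intrinsicInterior ℝ (convexHull ℝ (↑s : Set (EuclideanSpace ℝ (Fin n))))

/-- The continuous map `f : |K| → ℝ^d` has an `r`-Tverberg point: there are `r` points of
`|K|` with pairwise (vertex-)disjoint supports mapped to the same point. -/
def HasTverbergPoint {n d : ℕ} (K : Geometry.SimplicialComplex ℝ (EuclideanSpace ℝ (Fin n)))
    (r : ℕ) (f : EuclideanSpace ℝ (Fin n) → EuclideanSpace ℝ (Fin d)) : Prop :=
  ∃ (x : Fin r → EuclideanSpace ℝ (Fin n)) (s : Fin r → Finset (EuclideanSpace ℝ (Fin n))),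
    (∀ i, IsSupportFace K (x i) (s i)) ∧
    (Pairwise fun i j => Disjoint (s i) (s j)) ∧
    (∀ i j, f (x i) = f (x j))

/-- The `r`-fold deleted product `K^r_Δ` of `K`, as a subspace of `((ℝ^n))^r`. -/
def deletedProduct {n : ℕ} (K : Geometry.SimplicialComplex ℝ (EuclideanSpace ℝ (Fin n)))
    (r : ℕ) : Set (Fin r → EuclideanSpace ℝ (Fin n)) :=
  {x | ∃ s : Fin r → Finset (EuclideanSpace ℝ (Fin n)),
    (∀ i, IsSupportFace K (x i) (s i)) ∧ Pairwise fun i j => Disjoint (s i) (s j)}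

/-- The sphere `S^{d(r-1)-1} = {(y_1,…,y_r) ∈ (ℝ^d)^r : Σ y_i = 0, Σ ‖y_i‖² = 1}`. -/
def tvSphere (d r : ℕ) : Set (Fin r → EuclideanSpace ℝ (Fin d)) :=
  {y | (∑ i, y i) = 0 ∧ (∑ i, ‖y i‖ ^ 2) = 1}

/-- There exists an `S_r`-equivariant continuous map `K^r_Δ → S^{d(r-1)-1}`. -/
def ExistsEquivariantMap {n : ℕ} (K : Geometry.SimplicialComplex ℝ (EuclideanSpace ℝ (Fin n)))
    (r d : ℕ) : Prop :=
  ∃ F : (Fin r → EuclideanSpace ℝ (Fin n)) → (Fin r → EuclideanSpace ℝ (Fin d)),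
    ContinuousOn F (deletedProduct K r) ∧
    MapsTo F (deletedProduct K r) (tvSphere d r) ∧
    ∀ x ∈ deletedProduct K r, ∀ π : Equiv.Perm (Fin r),
      F (fun i => x (π i)) = fun i => F x (π i)

/-- `K` has dimension `m`: every face has at most `m+1` vertices and some face has
exactly `m+1` vertices. -/
def HasDimension {n : ℕ} (K : Geometry.SimplicialComplex ℝ (EuclideanSpace ℝ (Fin n)))
    (m : ℕ) : Prop :=
  (∀ s ∈ K.faces, s.card ≤ m + 1) ∧ ∃ s ∈ K.faces, s.card = m + 1

open Set MeasureTheory Topology Module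

section PT
set_option linter.unusedSectionVars false

variable {X E W : Type*} [NormedAddCommGroup X] [NormedSpace ℝ X] [FiniteDimensional ℝ X]
  [NormedAddCommGroup E] [NormedSpace ℝ E] [FiniteDimensional ℝ E]
  [NormedAddCommGroup W] [NormedSpace ℝ W] [FiniteDimensional ℝ W]

theorem exists_surj_of_finrank_le (h : finrank ℝ X ≤ finrank ℝ E) :
    ∃ p : E →L[ℝ] X, Function.Surjective p := by
  have h1 : finrank ℝ E = finrank ℝ (X × (Fin (finrank ℝ E - finrank ℝ X) → ℝ)) := by
    simp; omega
  let e : E ≃L[ℝ] _ := ContinuousLinearEquiv.ofFinrankEq h1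
  refine ⟨(ContinuousLinearMap.fst ℝ X _).comp e.toContinuousLinearMap, ?_⟩
  intro x
  refine ⟨e.symm (x, 0), ?_⟩
  simp

theorem not_surj_iff_det {p : E →L[ℝ] X} (hp : Function.Surjective p) (T : X →L[ℝ] E) :
    ¬ Function.Surjective T ↔ (T.comp p).det = 0 := by
  have h2 : Function.Surjective T ↔ Function.Surjective (T.comp p : E →ₗ[ℝ] E) := by
    constructor
    · intro h
      exact h.comp hp
    · intro h
      exact Function.Surjective.of_comp (g := p) h
  rw [h2, not_iff_comm, ContinuousLinearMap.det]
  rw [← LinearMap.injective_iff_surjective, ← LinearMap.ker_eq_bot]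
  constructor
  · intro h
    by_contra hb
    exact h (LinearMap.det_eq_zero_iff_ker_ne_bot.2 hb)
  · intro h hb
    exact (LinearMap.det_eq_zero_iff_ker_ne_bot.1 hb) h

theorem miniSard [MeasurableSpace E] [BorelSpace E] (ν : Measure E) [ν.IsAddHaarMeasure]
    (hdim : finrank ℝ X ≤ finrank ℝ E) (Θ : X → E) (Θ' : X → X →L[ℝ] E) (C : Set X)
    (h : ∀ x ∈ C, HasFDerivAt Θ (Θ' x) x) (hs : ∀ x ∈ C, ¬ Function.Surjective (Θ' x)) :
    ν (Θ '' C) = 0 := by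
  obtain ⟨p, hp⟩ := exists_surj_of_finrank_le hdim
  have h3 : ν ((Θ ∘ p) '' (p ⁻¹' C)) = 0 := by
    apply addHaar_image_eq_zero_of_det_fderivWithin_eq_zero ν (f' := fun e => (Θ' (p e)).comp p)
    · intro e he
      exact ((h (p e) he).comp e p.hasFDerivAt).hasFDerivWithinAt
    · intro e he
      exact (not_surj_iff_det hp _).1 (hs _ he)
  rwa [image_comp, image_preimage_eq _ hp] at h3

theorem null_of_sections [MeasurableSpace E] [BorelSpace E] (ν : Measure E) [ν.IsAddHaarMeasure]
    [MeasurableSpace W] [BorelSpace W] (μ : Measure W) [μ.IsAddHaarMeasure]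
    (L : E →L[ℝ] W) (B : Set W) (hB : MeasurableSet B)
    (h : ∀ w, ν {e | w + L e ∈ B} = 0) : μ B = 0 := by
  have hm : Measurable (fun q : W × E => q.1 + L q.2) := by fun_prop
  have hB' : MeasurableSet ((fun q : W × E => q.1 + L q.2) ⁻¹' B) := hm hB
  have h1 : (μ.prod ν) ((fun q : W × E => q.1 + L q.2) ⁻¹' B) = 0 := by
    rw [Measure.measure_prod_null hB']
    exact Filter.Eventually.of_forall h
  have hm2 : Measurable (fun q : E × W => q.2 + L q.1) := by fun_prop
  have h2 : (ν.prod μ) ((fun q : E × W => q.2 + L q.1) ⁻¹' B) = 0 := by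
    rw [← Measure.prod_swap, Measure.map_apply measurable_swap (hm2 hB)]
    exact h1
  have h3 := Measure.measure_ae_null_of_prod_null h2
  obtain ⟨e, he⟩ := h3.exists
  have h4 : μ ((fun w => w + L e) ⁻¹' B) = 0 := he
  rwa [measure_preimage_add_right] at h4

theorem paramTransLocal [MeasurableSpace E] [BorelSpace E]
    [MeasurableSpace W] [BorelSpace W] (μ : Measure W) [μ.IsAddHaarMeasure]
    (hdim : finrank ℝ X ≤ finrank ℝ E) (Φ : X → E) (Λ : X → W →L[ℝ] E)
    (hΦ : ContDiff ℝ 1 Φ) (hΛ : ContDiff ℝ 1 Λ) (x₀ : X) (hs : Function.Surjective (Λ x₀)) :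
    ∃ U ∈ 𝓝 x₀, μ {w | ∃ x ∈ U, Φ x + Λ x w = 0 ∧
      ¬ Function.Surjective (fderiv ℝ Φ x + (fderiv ℝ Λ x).flip w)} = 0 := by
  obtain ⟨p, hp⟩ := exists_surj_of_finrank_le hdim
  obtain ⟨L, hL⟩ := (Λ x₀ : W →ₗ[ℝ] E).exists_rightInverse_of_surjective
    (LinearMap.range_eq_top.2 hs)
  let L' : E →L[ℝ] W := LinearMap.toContinuousLinearMap L
  have hL' : ∀ e, Λ x₀ (L' e) = e := fun e => LinearMap.congr_fun hL e
  let M : X → E →L[ℝ] E := fun x => (Λ x).comp L'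
  have hM : ContDiff ℝ 1 M := hΛ.clm_comp contDiff_const
  have hM0 : M x₀ = 1 := by ext e; exact hL' e
  have hopen : {x | IsUnit (M x)} ∈ 𝓝 x₀ := by
    have h1 : ∀ᶠ T in 𝓝 (M x₀), IsUnit T := by
      rw [hM0]
      exact (Units.isOpen (R := E →L[ℝ] E)).mem_nhds isUnit_one
    exact hM.continuous.continuousAt.eventually h1
  obtain ⟨r, hr, hball⟩ := Metric.nhds_basis_closedBall.mem_iff.1 hopen
  refine ⟨Metric.closedBall x₀ r, Metric.closedBall_mem_nhds _ hr, ?_⟩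
  set B := {w | ∃ x ∈ Metric.closedBall x₀ r, Φ x + Λ x w = 0 ∧
      ¬ Function.Surjective (fderiv ℝ Φ x + (fderiv ℝ Λ x).flip w)} with hBdef
  have hdΦ : Continuous (fderiv ℝ Φ) := hΦ.continuous_fderiv (by norm_num)
  have hdΛ : Continuous (fderiv ℝ Λ) := hΛ.continuous_fderiv (by norm_num)
  have hBclosed : IsClosed B := by
    have hC : IsCompact (Metric.closedBall x₀ r) := isCompact_closedBall _ _
    have : B = Prod.snd '' ({q : Metric.closedBall x₀ r × W |
        Φ q.1 + Λ q.1 q.2 = 0 ∧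
        ((fderiv ℝ Φ q.1 + (fderiv ℝ Λ q.1).flip q.2).comp p).det = 0}) := by
      ext w
      simp only [hBdef, mem_ofPred_eq, mem_image, Prod.exists, Subtype.exists]
      constructor
      · rintro ⟨x, hx, h1, h2⟩
        exact ⟨x, hx, w, ⟨h1, (not_surj_iff_det hp _).1 h2⟩, rfl⟩
      · rintro ⟨x, hx, w', ⟨h1, h2⟩, rfl⟩
        exact ⟨x, hx, h1, (not_surj_iff_det hp _).2 h2⟩
    rw [this]
    have : CompactSpace (Metric.closedBall x₀ r) := isCompact_iff_compactSpace.1 hC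
    apply isClosedMap_snd_of_compactSpace
    apply IsClosed.inter
    · apply isClosed_eq _ continuous_const
      have := hΦ.continuous
      have := hΛ.continuous
      fun_prop
    · apply isClosed_eq _ continuous_const
      apply ContinuousLinearMap.continuous_det.comp
      have h1 : Continuous fun q : Metric.closedBall x₀ r × W => (fderiv ℝ Λ q.1).flip := by
        have := (ContinuousLinearMap.flipₗᵢ ℝ X W E).continuous
        exact this.comp (by fun_prop)
      fun_prop
  apply null_of_sections (Measure.addHaar : Measure E) μ L' B hBclosed.measurableSet
  intro w
  let Θ : X → E := fun x => - Ring.inverse (M x) (Φ x + Λ x w)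
  have key : ∀ x ∈ Metric.closedBall x₀ r, ∀ e, Φ x + Λ x (w + L' e) = M x (e - Θ x) := by
    intro x hx e
    have hu : IsUnit (M x) := hball hx
    have : M x (Ring.inverse (M x) (Φ x + Λ x w)) = Φ x + Λ x w := by
      rw [← mul_apply_eq_comp, Ring.mul_inverse_cancel _ hu]; rfl
    simp only [Θ, sub_neg_eq_add]
    rw [map_add (M x), this, map_add (Λ x)]
    simp only [M, ContinuousLinearMap.comp_apply]
    abel
  have hΘd : ∀ x ∈ Metric.closedBall x₀ r, DifferentiableAt ℝ Θ x := by
    intro x hx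
    have hu : IsUnit (M x) := hball hx
    obtain ⟨u, hu⟩ := hu
    have hi : DifferentiableAt ℝ (fun x => Ring.inverse (M x)) x := by
      have h1 : DifferentiableAt ℝ Ring.inverse (M x) := by
        rw [← hu]; exact differentiableAt_inverse  u.isUnit
      exact h1.comp x (hM.differentiable (by norm_num) x)
    have h2 := hΦ.differentiable (by norm_num) x
    have h3 := hΛ.differentiable (by norm_num) x
    exact (hi.clm_apply (h2.add (h3.clm_apply (differentiableAt_const w)))).neg
  let C : Set X := {x ∈ Metric.closedBall x₀ r | ¬ Function.Surjective (fderiv ℝ Θ x)}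
  refine measure_mono_null ?_ (miniSard (Measure.addHaar : Measure E) hdim Θ (fderiv ℝ Θ) C
    (fun x hx => (hΘd x hx.1).hasFDerivAt) (fun x hx => hx.2))
  rintro e ⟨x, hx, h1, h2⟩
  have hu : IsUnit (M x) := hball hx
  have hinj : ∀ a, M x a = 0 → a = 0 := by
    intro a ha
    have : (Ring.inverse (M x) * M x) a = 0 := by
      rw [mul_apply_eq_comp, ha, map_zero]
    rwa [Ring.inverse_mul_cancel _ hu] at this
  have hsurM : Function.Surjective (M x) := by
    intro a
    refine ⟨Ring.inverse (M x) a, ?_⟩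
    rw [← mul_apply_eq_comp, Ring.mul_inverse_cancel _ hu]; rfl
  rw [key x hx] at h1
  have he : e = Θ x := sub_eq_zero.1 (hinj _ h1)
  refine ⟨x, ⟨hx, ?_⟩, he.symm⟩
  intro hsur
  apply h2
  -- derivative identity: near x, Φ + Λ (w + L' e) = M (e - Θ)
  have hMd := hM.differentiable (by norm_num) x
  have hd1 : HasFDerivAt (fun y => Φ y + Λ y (w + L' e))
      (fderiv ℝ Φ x + (fderiv ℝ Λ x).flip (w + L' e)) x := by
    have h2 := (hΦ.differentiable (by norm_num) x).hasFDerivAt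
    have h3 := (hΛ.differentiable (by norm_num) x).hasFDerivAt
    have h4 := h2.add (h3.clm_apply (hasFDerivAt_const (w + L' e) x))
    rw [ContinuousLinearMap.comp_zero, zero_add] at h4
    exact h4
  have hd2 : HasFDerivAt (fun y => Φ y + Λ y w + M y e)
      (fderiv ℝ Φ x + (fderiv ℝ Λ x).flip (w + L' e)) x := by
    refine hd1.congr_of_eventuallyEq (Filter.Eventually.of_forall fun y => ?_)
    simp [M, add_assoc]
  -- M y (Θ y) = - (Φ y + Λ y w) near x, differentiate
  have hnear : ∀ᶠ y in 𝓝 x, IsUnit (M y) := by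
    apply hM.continuous.continuousAt.eventually
    exact (Units.isOpen (R := E →L[ℝ] E)).mem_nhds hu
  have hd3 : HasFDerivAt (fun y => M y (e - Θ y)) 
      ((M x).comp (- fderiv ℝ Θ x) + (fderiv ℝ M x).flip (e - Θ x)) x := by
    have := hMd.hasFDerivAt.clm_apply ((hΘd x hx).hasFDerivAt.const_sub e)
    simpa using this
  have hd4 : HasFDerivAt (fun y => Φ y + Λ y w + M y e)
     ((M x).comp (- fderiv ℝ Θ x) + (fderiv ℝ M x).flip (e - Θ x)) x := by
    refine hd3.congr_of_eventuallyEq ?_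
    filter_upwards [hnear] with y hy
    have : M y (Ring.inverse (M y) (Φ y + Λ y w)) = Φ y + Λ y w := by
      rw [← mul_apply_eq_comp, Ring.mul_inverse_cancel _ hy]; rfl
    simp only [Θ, sub_neg_eq_add, map_add (M y), this]
    abel
  rw [hd2.unique hd4, he, sub_self, map_zero, add_zero]
  have : Function.Surjective (fun v => - fderiv ℝ Θ x v) := 
    (neg_surjective).comp hsur
  exact hsurM.comp this

theorem paramTrans [MeasurableSpace E] [BorelSpace E]
    [MeasurableSpace W] [BorelSpace W] (μ : Measure W) [μ.IsAddHaarMeasure]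
    (hdim : finrank ℝ X ≤ finrank ℝ E) (Φ : X → E) (Λ : X → W →L[ℝ] E)
    (hΦ : ContDiff ℝ 1 Φ) (hΛ : ContDiff ℝ 1 Λ) (C : Set X)
    (hs : ∀ x ∈ C, Function.Surjective (Λ x)) :
    ∀ᵐ w ∂μ, ∀ x ∈ C, Φ x + Λ x w = 0 →
      Function.Surjective (fderiv ℝ Φ x + (fderiv ℝ Λ x).flip w) := by
  have h := fun x : C => paramTransLocal μ hdim Φ Λ hΦ hΛ x.1 (hs x.1 x.2)
  choose U hU hUn using h
  classical
  let f : X → Set X := fun x => if hx : x ∈ C then U ⟨x, hx⟩ else univ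
  obtain ⟨t, htC, htc, hcov⟩ := TopologicalSpace.countable_cover_nhdsWithin (s := C) (f := f)
    (by intro x hx; simp only [f, hx, dif_pos]; exact mem_nhdsWithin_of_mem_nhds (hU ⟨x, hx⟩))
  have : ∀ᵐ w ∂μ, ∀ c ∈ t, ∀ x ∈ f c, Φ x + Λ x w = 0 →
      Function.Surjective (fderiv ℝ Φ x + (fderiv ℝ Λ x).flip w) := by
    rw [ae_ball_iff htc]
    intro c hc
    have hcC := htC hc
    rw [ae_iff]
    refine measure_mono_null ?_ (hUn ⟨c, hcC⟩)
    intro w hw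
    simp only [mem_ofPred_eq, f, hcC, dif_pos] at hw
    push Not at hw
    exact hw
  filter_upwards [this] with w hw x hx h0
  obtain ⟨c, hc, hxc⟩ := mem_iUnion₂.1 (hcov hx)
  exact hw c hc x hxc h0

/-- No zeros at all if the dimension is too small. -/
theorem paramTrans_lt [MeasurableSpace E] [BorelSpace E]
    [MeasurableSpace W] [BorelSpace W] (μ : Measure W) [μ.IsAddHaarMeasure]
    (hdim : finrank ℝ X < finrank ℝ E) (Φ : X → E) (Λ : X → W →L[ℝ] E)
    (hΦ : ContDiff ℝ 1 Φ) (hΛ : ContDiff ℝ 1 Λ) (C : Set X)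
    (hs : ∀ x ∈ C, Function.Surjective (Λ x)) :
    ∀ᵐ w ∂μ, ∀ x ∈ C, Φ x + Λ x w ≠ 0 := by
  filter_upwards [paramTrans μ hdim.le Φ Λ hΦ hΛ C hs] with w hw x hx h0
  have := LinearMap.finrank_le_finrank_of_surjective
    (f := (fderiv ℝ Φ x + (fderiv ℝ Λ x).flip w : X →L[ℝ] E).toLinearMap) (hw x hx h0)
  omega

end PT

open Set MeasureTheory Topology Module


section Pert

/-- The space of coefficients of cubic perturbations. -/
abbrev PertW (n : ℕ) (E : Type*) := (Fin 3 → Option (Fin n)) → E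

def pertHat {n : ℕ} (x : EuclideanSpace ℝ (Fin n)) (o : Option (Fin n)) : ℝ :=
  o.elim 1 (fun i => x i)

def pertPhi {n : ℕ} (j : Fin 3 → Option (Fin n)) (x : EuclideanSpace ℝ (Fin n)) : ℝ :=
  ∏ k, pertHat x (j k)

variable {n : ℕ} {E : Type*} [NormedAddCommGroup E] [NormedSpace ℝ E]

def pertLam (x : EuclideanSpace ℝ (Fin n)) : PertW n E →L[ℝ] E :=
  ∑ j, pertPhi j x • ContinuousLinearMap.proj (R := ℝ) (φ := fun _ => E) j

theorem pertLam_apply (x : EuclideanSpace ℝ (Fin n)) (w : PertW n E) :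
    pertLam x w = ∑ j, pertPhi j x • w j := by
  simp [pertLam, ContinuousLinearMap.sum_apply]

theorem contDiff_pertHat (o : Option (Fin n)) {N : WithTop ℕ∞} :
    ContDiff ℝ N (fun x : EuclideanSpace ℝ (Fin n) => pertHat x o) := by
  cases o with
  | none => simp only [pertHat, Option.elim]; exact contDiff_const
  | some i => simp only [pertHat, Option.elim]; fun_prop

theorem contDiff_pertPhi (j : Fin 3 → Option (Fin n)) {N : WithTop ℕ∞} :
    ContDiff ℝ N (pertPhi j) := by
  unfold pertPhi
  exact contDiff_prod (fun k _ => contDiff_pertHat (j k))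

theorem contDiff_pertLam {N : WithTop ℕ∞} :
    ContDiff ℝ N (pertLam : EuclideanSpace ℝ (Fin n) → PertW n E →L[ℝ] E) := by
  unfold pertLam
  exact ContDiff.sum (fun j _ => (contDiff_pertPhi j).smul contDiff_const)

theorem pert_sep (a : EuclideanSpace ℝ (Fin n)) (b : Fin 3 → EuclideanSpace ℝ (Fin n))
    (hb : ∀ k, b k ≠ a) (e : E) :
    ∃ w : PertW n E, pertLam a w = e ∧ ∀ k, pertLam (b k) w = 0 := by
  let c : Fin 3 → Option (Fin n) → ℝ := fun k o =>
    o.elim (- inner ℝ (b k) (a - b k) / ‖a - b k‖ ^ 2) (fun i => (a - b k) i / ‖a - b k‖ ^ 2)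
  have hc : ∀ k (x : EuclideanSpace ℝ (Fin n)),
      ∑ o, pertHat x o * c k o = inner ℝ (x - b k) (a - b k) / ‖a - b k‖ ^ 2 := by
    intro k x
    rw [Fintype.sum_option, inner_sub_left]
    have : inner ℝ x (a - b k) = ∑ i, x i * (a - b k) i := by
      simp [PiLp.inner_apply, mul_comm]
    rw [this]
    simp only [pertHat, Option.elim, c]
    rw [sub_div, Finset.sum_div]
    simp only [mul_div_assoc]
    ring
  have hw : ∀ x, pertLam x (fun j => (∏ k, c k (j k)) • e) =
      (∏ k, inner ℝ (x - b k) (a - b k) / ‖a - b k‖ ^ 2) • e := by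
    intro x
    rw [pertLam_apply]
    simp only [← hc, smul_smul, ← Finset.sum_smul]
    congr 1
    rw [Finset.prod_univ_sum]
    simp [pertPhi, Finset.prod_mul_distrib]
  refine ⟨fun j => (∏ k, c k (j k)) • e, ?_, ?_⟩
  · rw [hw]
    have : ∀ k, inner ℝ (a - b k) (a - b k) / ‖a - b k‖ ^ 2 = 1 := by
      intro k
      rw [real_inner_self_eq_norm_sq, div_self]
      have := sub_ne_zero.2 (hb k).symm
      positivity
    rw [Finset.prod_congr rfl (fun k _ => this k)]
    simp
  · intro k
    rw [hw, Finset.prod_eq_zero (Finset.mem_univ k) (by simp), zero_smul]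

theorem pert_imm (x t : EuclideanSpace ℝ (Fin n)) (ht : t ≠ 0) (e : E) :
    ∃ w : PertW n E, fderiv ℝ pertLam x t w = e := by
  obtain ⟨i, hi⟩ : ∃ i, t i ≠ 0 := by
    by_contra h
    push Not at h
    exact ht (by ext i; simpa using h i)
  let j : Fin 3 → Option (Fin n) := fun k => if k = 0 then some i else none
  have hj : ∀ y : EuclideanSpace ℝ (Fin n), pertPhi j y = y i := by
    intro y
    simp [pertPhi, Fin.prod_univ_succ, j, pertHat]
  let w : PertW n E := Pi.single j ((t i)⁻¹ • e)
  refine ⟨w, ?_⟩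
  have h1 : HasFDerivAt (fun y : EuclideanSpace ℝ (Fin n) => pertLam y w)
      ((fderiv ℝ pertLam x).flip w) x := by
    have h3 := ((contDiff_pertLam (N := 1) (n := n) (E := E)).differentiable
      (by norm_num) x).hasFDerivAt
    have := h3.clm_apply (hasFDerivAt_const w x)
    simpa using this
  have h2 : (fun y : EuclideanSpace ℝ (Fin n) => pertLam y w) =
      fun y => (y i) • ((t i)⁻¹ • e) := by
    funext y
    rw [pertLam_apply, Finset.sum_eq_single j]
    · simp [w, hj]
    · intro b _ hb; simp [w, hb]
    · simp
  rw [h2] at h1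
  have h3 : HasFDerivAt (fun y : EuclideanSpace ℝ (Fin n) => (y i) • ((t i)⁻¹ • e))
      ((EuclideanSpace.proj i : EuclideanSpace ℝ (Fin n) →L[ℝ] ℝ).smulRight ((t i)⁻¹ • e)) x := by
    exact ((EuclideanSpace.proj i : EuclideanSpace ℝ (Fin n) →L[ℝ] ℝ).smulRight
      ((t i)⁻¹ • e)).hasFDerivAt
  have h4 := congrArg (fun T => T t) (h1.unique h3)
  simp only [ContinuousLinearMap.flip_apply] at h4
  rw [h4]
  simp [smul_smul, hi]

end Pert

open Set MeasureTheory Topology Module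


section Generic
set_option linter.unusedSectionVars false

theorem fderiv_param {X E W : Type*} [NormedAddCommGroup X] [NormedSpace ℝ X]
    [NormedAddCommGroup E] [NormedSpace ℝ E] [NormedAddCommGroup W] [NormedSpace ℝ W]
    {Φ : X → E} {Λ : X → W →L[ℝ] E}
    (hΦ : ContDiff ℝ 1 Φ) (hΛ : ContDiff ℝ 1 Λ) (w : W) (x : X) :
    fderiv ℝ (fun x => Φ x + Λ x w) x = fderiv ℝ Φ x + (fderiv ℝ Λ x).flip w := by
  have h1 := ((hΛ.differentiable (by norm_num) x).hasFDerivAt).clm_apply (hasFDerivAt_const w x)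
  have h2 := ((hΦ.differentiable (by norm_num) x).hasFDerivAt).add h1
  have h3 := h2.fderiv
  simp only [ContinuousLinearMap.comp_zero, zero_add] at h3
  exact h3

variable {n d : ℕ}

/-- the perturbed map -/
def pertG (F : EuclideanSpace ℝ (Fin n) → EuclideanSpace ℝ (Fin d))
    (w : PertW n (EuclideanSpace ℝ (Fin d))) (x : EuclideanSpace ℝ (Fin n)) :
    EuclideanSpace ℝ (Fin d) := F x + pertLam x w

theorem contDiff_pertG {F : EuclideanSpace ℝ (Fin n) → EuclideanSpace ℝ (Fin d)}
    {N : WithTop ℕ∞}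
    (hF : ContDiff ℝ N F) (w : PertW n (EuclideanSpace ℝ (Fin d))) :
    ContDiff ℝ N (pertG F w) := by
  unfold pertG
  exact hF.add (contDiff_pertLam.clm_apply contDiff_const)

theorem generic_four {X : Type*} [NormedAddCommGroup X] [NormedSpace ℝ X] [FiniteDimensional ℝ X]
    {F : EuclideanSpace ℝ (Fin n) → EuclideanSpace ℝ (Fin d)} (hF : ContDiff ℝ 1 F)
    (hX : finrank ℝ X < d + d) {a b c e : X → EuclideanSpace ℝ (Fin n)}
    (ha : ContDiff ℝ 1 a) (hb : ContDiff ℝ 1 b) (hc : ContDiff ℝ 1 c) (he : ContDiff ℝ 1 e) :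
    ∀ᵐ w : PertW n (EuclideanSpace ℝ (Fin d)), ∀ x, a x ≠ b x → a x ≠ c x → a x ≠ e x →
      c x ≠ b x → c x ≠ e x →
      ¬ (pertG F w (a x) = pertG F w (b x) ∧ pertG F w (c x) = pertG F w (e x)) := by
  have key := paramTrans_lt (X := X)
    (E := EuclideanSpace ℝ (Fin d) × EuclideanSpace ℝ (Fin d))
    (W := PertW n (EuclideanSpace ℝ (Fin d))) volume (by simpa using hX)
    (fun x => (F (a x) - F (b x), F (c x) - F (e x)))
    (fun x => ContinuousLinearMap.prod (pertLam (a x) - pertLam (b x))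
      (pertLam (c x) - pertLam (e x)))
    (((hF.comp ha).sub (hF.comp hb)).prodMk ((hF.comp hc).sub (hF.comp he)))
    (by
      have h1 := (contDiff_pertLam (N := 1) (n := n) (E := EuclideanSpace ℝ (Fin d))).comp ha
      have h2 := (contDiff_pertLam (N := 1) (n := n) (E := EuclideanSpace ℝ (Fin d))).comp hb
      have h3 := (contDiff_pertLam (N := 1) (n := n) (E := EuclideanSpace ℝ (Fin d))).comp hc
      have h4 := (contDiff_pertLam (N := 1) (n := n) (E := EuclideanSpace ℝ (Fin d))).comp he
      exact (ContinuousLinearMap.prodMapL ℝ (PertW n (EuclideanSpace ℝ (Fin d))) (EuclideanSpace ℝ (Fin d)) (PertW n (EuclideanSpace ℝ (Fin d))) (EuclideanSpace ℝ (Fin d))).contDiff.comp ((h1.sub h2).prodMk (h3.sub h4)) |>.clm_comp (contDiff_const (c := (ContinuousLinearMap.id ℝ _).prod (ContinuousLinearMap.id ℝ _))))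
    {x | a x ≠ b x ∧ a x ≠ c x ∧ a x ≠ e x ∧ c x ≠ b x ∧ c x ≠ e x}
    (by
      rintro x ⟨h1, h2, h3, h4, h5⟩ ⟨e1, e2⟩
      obtain ⟨w1, hw1, hw1'⟩ := pert_sep (a x) ![b x, c x, e x]
        (by intro k; fin_cases k; exacts [h1.symm, h2.symm, h3.symm]) e1
      obtain ⟨w2, hw2, hw2'⟩ := pert_sep (c x) ![b x, a x, e x]
        (by intro k; fin_cases k; exacts [h4.symm, h2, h5.symm]) e2
      have a1 := hw1' 0
      have a2 := hw1' 1
      have a3 := hw1' 2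
      have b1 := hw2' 0
      have b2 := hw2' 1
      have b3 := hw2' 2
      simp at a1 a2 a3 b1 b2 b3
      refine ⟨w1 + w2, ?_⟩
      simp [hw1, hw2, a1, a2, a3, b1, b2, b3])
  filter_upwards [key] with w hw x h1 h2 h3 h4 h5 ⟨h6, h7⟩
  apply hw x ⟨h1, h2, h3, h4, h5⟩
  simp only [pertG] at h6 h7
  simp only [ContinuousLinearMap.prod_apply, Prod.mk_add_mk, ContinuousLinearMap.sub_apply,
    Prod.mk_eq_zero]
  constructor
  · rw [← sub_eq_zero.2 h6]; abel
  · rw [← sub_eq_zero.2 h7]; abel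

theorem generic_Q {F : EuclideanSpace ℝ (Fin n) → EuclideanSpace ℝ (Fin d)}
    (hF : ContDiff ℝ 1 F)
    (p q : EuclideanSpace ℝ (Fin n)) (D D' : Submodule ℝ (EuclideanSpace ℝ (Fin n)))
    (hd : finrank ℝ D + finrank ℝ D' ≤ d) :
    ∀ᵐ w : PertW n (EuclideanSpace ℝ (Fin d)), ∀ u ∈ D, ∀ v ∈ D', p + u ≠ q + v →
      pertG F w (p + u) = pertG F w (q + v) → ∀ s ∈ D, ∀ t ∈ D',
      fderiv ℝ (pertG F w) (p + u) s = fderiv ℝ (pertG F w) (q + v) t → s = 0 ∧ t = 0 := by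
  have ha : ContDiff ℝ 1 (fun x : D × D' => p + (x.1 : EuclideanSpace ℝ (Fin n))) :=
    contDiff_const.add (D.subtypeL.contDiff.comp contDiff_fst)
  have hb : ContDiff ℝ 1 (fun x : D × D' => q + (x.2 : EuclideanSpace ℝ (Fin n))) :=
    contDiff_const.add (D'.subtypeL.contDiff.comp contDiff_snd)
  have hL := contDiff_pertLam (N := 1) (n := n) (E := EuclideanSpace ℝ (Fin d))
  have hΦ : ContDiff ℝ 1 (fun x : D × D' => F (p + (x.1 : EuclideanSpace ℝ (Fin n))) - F (q + (x.2 : EuclideanSpace ℝ (Fin n)))) :=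
    (hF.comp ha).sub (hF.comp hb)
  have hΛ : ContDiff ℝ 1 (fun x : D × D' => (pertLam (p + (x.1 : EuclideanSpace ℝ (Fin n))) - pertLam (q + (x.2 : EuclideanSpace ℝ (Fin n))) :
    PertW n (EuclideanSpace ℝ (Fin d)) →L[ℝ] EuclideanSpace ℝ (Fin d))) :=
    (hL.comp ha).sub (hL.comp hb)
  have key := paramTrans (X := D × D') (E := EuclideanSpace ℝ (Fin d))
    (W := PertW n (EuclideanSpace ℝ (Fin d))) volume (by simpa using hd)
    _ _ hΦ hΛ {x | p + (x.1 : EuclideanSpace ℝ (Fin n)) ≠ q + x.2}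
    (by
      intro x hx e1
      obtain ⟨w1, hw1, hw1'⟩ := pert_sep (p + (x.1 : EuclideanSpace ℝ (Fin n))) (fun _ => q + x.2) (fun _ => Ne.symm hx) e1
      refine ⟨w1, ?_⟩
      simp [hw1, hw1' 0])
  filter_upwards [key] with w hw u hu v hv huv hG s hs t ht hst
  have hsur := hw (⟨u, hu⟩, ⟨v, hv⟩) huv (by
    simp only [pertG] at hG
    simp only [ContinuousLinearMap.sub_apply]
    rw [← sub_eq_zero.2 hG]; abel)
  rw [← fderiv_param hΦ hΛ] at hsur
  have hG1 := contDiff_pertG hF w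
  have hfd : HasFDerivAt (fun x : D × D' => (F (p + (x.1 : EuclideanSpace ℝ (Fin n))) - F (q + (x.2 : EuclideanSpace ℝ (Fin n)))) +
      (pertLam (p + (x.1 : EuclideanSpace ℝ (Fin n))) - pertLam (q + (x.2 : EuclideanSpace ℝ (Fin n))) :
    PertW n (EuclideanSpace ℝ (Fin d)) →L[ℝ] EuclideanSpace ℝ (Fin d)) w)
    ((fderiv ℝ (pertG F w) (p + u)).comp (D.subtypeL.comp (ContinuousLinearMap.fst ℝ D D')) -
     (fderiv ℝ (pertG F w) (q + v)).comp (D'.subtypeL.comp (ContinuousLinearMap.snd ℝ D D')))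
     (⟨u, hu⟩, ⟨v, hv⟩) := by
    have e1 : (fun x : D × D' => (F (p + (x.1 : EuclideanSpace ℝ (Fin n))) - F (q + (x.2 : EuclideanSpace ℝ (Fin n)))) +
      (pertLam (p + (x.1 : EuclideanSpace ℝ (Fin n))) - pertLam (q + (x.2 : EuclideanSpace ℝ (Fin n))) :
    PertW n (EuclideanSpace ℝ (Fin d)) →L[ℝ] EuclideanSpace ℝ (Fin d)) w) =
      fun x => pertG F w (p + (x.1 : EuclideanSpace ℝ (Fin n))) - pertG F w (q + (x.2 : EuclideanSpace ℝ (Fin n))) := by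
      funext x; simp only [pertG, ContinuousLinearMap.sub_apply]; abel
    rw [e1]
    have k1 : HasFDerivAt (fun x : D × D' => p + (x.1 : EuclideanSpace ℝ (Fin n)))
      (D.subtypeL.comp (ContinuousLinearMap.fst ℝ D D')) (⟨u, hu⟩, ⟨v, hv⟩) :=
      ((D.subtypeL.comp (ContinuousLinearMap.fst ℝ D D')).hasFDerivAt).const_add p
    have k2 : HasFDerivAt (fun x : D × D' => q + (x.2 : EuclideanSpace ℝ (Fin n)))
      (D'.subtypeL.comp (ContinuousLinearMap.snd ℝ D D')) (⟨u, hu⟩, ⟨v, hv⟩) :=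
      ((D'.subtypeL.comp (ContinuousLinearMap.snd ℝ D D')).hasFDerivAt).const_add q
    refine HasFDerivAt.sub ?_ ?_
    · exact HasFDerivAt.comp ((⟨u, hu⟩, ⟨v, hv⟩) : D × D')
        (g := pertG F w) (hG1.differentiable (by norm_num) _).hasFDerivAt k1
    · exact HasFDerivAt.comp ((⟨u, hu⟩, ⟨v, hv⟩) : D × D')
        (g := pertG F w) (hG1.differentiable (by norm_num) _).hasFDerivAt k2
  rw [hfd.fderiv] at hsur
  set T := ((fderiv ℝ (pertG F w) (p + u)).comp (D.subtypeL.comp (ContinuousLinearMap.fst ℝ D D')) -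
     (fderiv ℝ (pertG F w) (q + v)).comp (D'.subtypeL.comp (ContinuousLinearMap.snd ℝ D D')))
     with hTdef
  have hr := LinearMap.finrank_le_finrank_of_surjective (f := T.toLinearMap) hsur
  have hinj : Function.Injective T.toLinearMap :=
    (LinearMap.injective_iff_surjective_of_finrank_eq_finrank (by simp at hr ⊢; omega)).2 hsur
  have h0 : T.toLinearMap (⟨s, hs⟩, ⟨t, ht⟩) = T.toLinearMap 0 := by
    rw [map_zero]
    simp [hTdef, hst]
  have := hinj h0
  simpa [Prod.ext_iff, Subtype.ext_iff] using this

theorem generic_P {F : EuclideanSpace ℝ (Fin n) → EuclideanSpace ℝ (Fin d)}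
    (hF : ContDiff ℝ 2 F)
    (p : EuclideanSpace ℝ (Fin n)) (D D' : Submodule ℝ (EuclideanSpace ℝ (Fin n)))
    (hd : finrank ℝ D + finrank ℝ D' ≤ d) :
    ∀ᵐ w : PertW n (EuclideanSpace ℝ (Fin d)), ∀ u ∈ D ⊓ D', ∀ t ∈ D ⊔ D',
      fderiv ℝ (pertG F w) (p + u) t = 0 → t = 0 := by
  have hF' : ContDiff ℝ 1 (fderiv ℝ F) := hF.fderiv_right (by norm_num)
  have hL := contDiff_pertLam (N := 2) (n := n) (E := EuclideanSpace ℝ (Fin d))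
  have hL' : ContDiff ℝ 1 (fderiv ℝ (pertLam : EuclideanSpace ℝ (Fin n) →
    PertW n (EuclideanSpace ℝ (Fin d)) →L[ℝ] EuclideanSpace ℝ (Fin d))) :=
    hL.fderiv_right (by norm_num)
  let X := ↥(D ⊓ D') × ↥(D ⊔ D')
  have ha : ContDiff ℝ 1 (fun x : X => p + (x.1 : EuclideanSpace ℝ (Fin n))) :=
    contDiff_const.add ((D ⊓ D').subtypeL.contDiff.comp contDiff_fst)
  have hb : ContDiff ℝ 1 (fun x : X => (x.2 : EuclideanSpace ℝ (Fin n))) :=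
    ((D ⊔ D').subtypeL.contDiff.comp contDiff_snd)
  have hΦ : ContDiff ℝ 1 (fun x : X => fderiv ℝ F (p + (x.1 : EuclideanSpace ℝ (Fin n))) x.2) :=
    (hF'.comp ha).clm_apply hb
  have hΛ : ContDiff ℝ 1 (fun x : X => (fderiv ℝ pertLam (p + (x.1 : EuclideanSpace ℝ (Fin n))) x.2 :
    PertW n (EuclideanSpace ℝ (Fin d)) →L[ℝ] EuclideanSpace ℝ (Fin d))) :=
    (hL'.comp ha).clm_apply hb
  have hX : finrank ℝ X ≤ finrank ℝ (EuclideanSpace ℝ (Fin d)) := by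
    simp only [X, finrank_prod, finrank_euclideanSpace, Fintype.card_fin]
    have := Submodule.finrank_sup_add_finrank_inf_eq D D'
    omega
  have key := paramTrans (X := X) (E := EuclideanSpace ℝ (Fin d))
    (W := PertW n (EuclideanSpace ℝ (Fin d))) volume hX
    _ _ hΦ hΛ {x | (x.2 : EuclideanSpace ℝ (Fin n)) ≠ 0}
    (by
      intro x hx e1
      exact pert_imm _ _ hx e1)
  filter_upwards [key] with w hw u hu t ht h0
  by_contra hne
  have hG1 : ∀ x, fderiv ℝ (pertG F w) x = fderiv ℝ F x + (fderiv ℝ pertLam x).flip w := by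
    intro x
    exact fderiv_param (hF.of_le (by norm_num)) (hL.of_le (by norm_num)) w x
  have hz : ∀ s : ℝ, fderiv ℝ F (p + u) (s • t) + fderiv ℝ pertLam (p + u) (s • t) w = 0 := by
    intro s
    rw [hG1] at h0
    simp only [ContinuousLinearMap.add_apply, ContinuousLinearMap.flip_apply] at h0
    rw [map_smul, map_smul, ContinuousLinearMap.smul_apply, ← smul_add, h0, smul_zero]
  have hsur := hw (⟨u, hu⟩, ⟨t, ht⟩) hne (by simpa using hz 1)
  rw [← fderiv_param hΦ hΛ] at hsur
  set H := (fun x : X => fderiv ℝ F (p + (x.1 : EuclideanSpace ℝ (Fin n))) x.2 + (fderiv ℝ pertLam (p + (x.1 : EuclideanSpace ℝ (Fin n))) x.2 :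
    PertW n (EuclideanSpace ℝ (Fin d)) →L[ℝ] EuclideanSpace ℝ (Fin d)) w) with hH
  set T := fderiv ℝ H (⟨u, hu⟩, ⟨t, ht⟩) with hT
  have hHd : HasFDerivAt H T (⟨u, hu⟩, ⟨t, ht⟩) :=
    ((hΦ.add (hΛ.clm_apply contDiff_const)).differentiable (by norm_num) _).hasFDerivAt
  have hr := LinearMap.finrank_le_finrank_of_surjective (f := T.toLinearMap) hsur
  have hinj : Function.Injective T.toLinearMap :=
    (LinearMap.injective_iff_surjective_of_finrank_eq_finrank (by omega)).2 hsur
  -- curve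
  let γ : ℝ → X := fun s => (⟨u, hu⟩, s • ⟨t, ht⟩)
  have hγ : HasDerivAt γ ((0, ⟨t, ht⟩) : X) 1 := by
    have h2 : HasDerivAt (fun s : ℝ => s • (⟨t, ht⟩ : ↥(D ⊔ D'))) (⟨t, ht⟩) 1 := by
      simpa using (hasDerivAt_id (1 : ℝ)).smul_const (⟨t, ht⟩ : ↥(D ⊔ D'))
    exact (hasDerivAt_const 1 (⟨u, hu⟩ : ↥(D ⊓ D'))).prodMk h2
  have hc : HasDerivAt (H ∘ γ) (T ((0, ⟨t, ht⟩) : X)) 1 := by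
    have e : γ 1 = (⟨u, hu⟩, ⟨t, ht⟩) := by simp [γ]
    rw [← e] at hHd
    exact hHd.comp_hasDerivAt 1 hγ
  have hc0 : H ∘ γ = fun _ => 0 := by
    funext s
    simpa [H, γ] using hz s
  rw [hc0] at hc
  have h5 := hc.unique (hasDerivAt_const 1 0)
  have h6 : T.toLinearMap ((0, ⟨t, ht⟩) : X) = T.toLinearMap 0 := by
    rw [map_zero]; exact h5
  have := hinj h6
  rw [Prod.ext_iff] at this
  exact hne (congrArg Subtype.val this.2)

end Generic

open Set MeasureTheory Topology Module


section Collapse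
set_option linter.unusedSectionVars false

variable {E ι : Type*} [NormedAddCommGroup E] [NormedSpace ℝ E] [Fintype ι]

theorem infDist_star {D : Set E} {c : E} (hD : IsCompact D) (hc : c ∈ D)
    (hs : StarConvex ℝ c D) (x : E) {r : ℝ} (h0 : 0 ≤ r) (h1 : r ≤ 1) :
    Metric.infDist (c + r • (x - c)) D ≤ r * Metric.infDist x D := by
  obtain ⟨y, hy, hxy⟩ := hD.exists_infDist_eq_dist ⟨c, hc⟩ x
  have hy' : c + r • (y - c) ∈ D := by
    have := hs hy (sub_nonneg.2 h1) h0 (by ring)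
    convert this using 1
    module
  calc Metric.infDist (c + r • (x - c)) D ≤ dist (c + r • (x - c)) (c + r • (y - c)) :=
        Metric.infDist_le_dist_of_mem hy'
    _ = r * Metric.infDist x D := by
        rw [hxy, dist_eq_norm, dist_eq_norm]
        have : c + r • (x - c) - (c + r • (y - c)) = r • (x - y) := by module
        rw [this, norm_smul, Real.norm_of_nonneg h0]

/-- The collapsing map. -/
def collapse (D : ι → Set E) (c : ι → E) (ε : ℝ) (x : E) : E :=
  x + ∑ i, (min 1 (Metric.infDist x (D i) / ε) - 1) • (x - c i)

/-- A good family of star-shaped sets. -/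
structure StarFam (D : ι → Set E) (c : ι → E) (ε : ℝ) : Prop where
  pos : 0 < ε
  compact : ∀ i, IsCompact (D i)
  mem : ∀ i, c i ∈ D i
  star : ∀ i, StarConvex ℝ (c i) (D i)
  sep : ∀ i j x, Metric.infDist x (D i) < ε → Metric.infDist x (D j) < ε → i = j

variable {D : ι → Set E} {c : ι → E} {ε : ℝ}

theorem collapse_continuous (D : ι → Set E) (c : ι → E) (ε : ℝ) :
    Continuous (collapse D c ε) := by
  unfold collapse
  have : ∀ i, Continuous fun x => Metric.infDist x (D i) := fun i =>
    Metric.continuous_infDist_pt _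
  refine continuous_id.add (continuous_finsetSum _ fun i _ => ?_)
  exact ((continuous_const.min ((this i).div_const ε)).sub continuous_const).smul
    (continuous_id.sub continuous_const)

theorem StarFam.off (h : StarFam D c ε) {x : E} (hx : ∀ i, ε ≤ Metric.infDist x (D i)) :
    collapse D c ε x = x := by
  unfold collapse
  rw [Finset.sum_eq_zero, add_zero]
  intro i _
  have : 1 ≤ Metric.infDist x (D i) / ε := by
    rw [le_div_iff₀ h.pos]; simpa using hx i
  rw [min_eq_left this]; simp

theorem StarFam.on (h : StarFam D c ε) {x : E} {i : ι} (hx : Metric.infDist x (D i) < ε) :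
    collapse D c ε x = c i + (Metric.infDist x (D i) / ε) • (x - c i) := by
  unfold collapse
  rw [Finset.sum_eq_single i]
  · have : Metric.infDist x (D i) / ε ≤ 1 := by
      rw [div_le_one h.pos]; exact hx.le
    rw [min_eq_right this]
    module
  · intro j _ hj
    have : 1 ≤ Metric.infDist x (D j) / ε := by
      rw [le_div_iff₀ h.pos]
      by_contra hlt
      push Not at hlt
      exact hj (h.sep j i x (by simpa using hlt) hx)
    rw [min_eq_left this]; simp
  · simp

theorem StarFam.on_mem (h : StarFam D c ε) {x : E} {i : ι} (hx : x ∈ D i) :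
    collapse D c ε x = c i := by
  have h0 : Metric.infDist x (D i) = 0 := Metric.infDist_zero_of_mem hx
  rw [h.on (by rw [h0]; exact h.pos), h0]; simp

theorem StarFam.nbhd (h : StarFam D c ε) {x : E} {i : ι} (hx : Metric.infDist x (D i) < ε) :
    Metric.infDist (collapse D c ε x) (D i) < ε := by
  rw [h.on hx]
  have h1 : Metric.infDist x (D i) / ε ≤ 1 := by
    rw [div_le_one h.pos]; exact hx.le
  have h0 : 0 ≤ Metric.infDist x (D i) / ε := div_nonneg Metric.infDist_nonneg h.pos.le
  have := infDist_star (h.compact i) (h.mem i) (h.star i) x h0 h1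
  have h2 := mul_le_of_le_one_left (Metric.infDist_nonneg (x := x) (s := D i)) h1
  linarith

theorem StarFam.inj (h : StarFam D c ε) {x y : E} (hxy : collapse D c ε x = collapse D c ε y) :
    x = y ∨ ∃ i, x ∈ D i ∧ y ∈ D i := by
  have hpos := h.pos
  have aux : ∀ x y i, Metric.infDist x (D i) < ε → Metric.infDist y (D i) < ε →
      Metric.infDist x (D i) ≤ Metric.infDist y (D i) →
      collapse D c ε x = collapse D c ε y → x = y ∨ ∃ i, x ∈ D i ∧ y ∈ D i := by
    intro x y i hx hy hle he
    rw [h.on hx, h.on hy] at he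
    set a := Metric.infDist x (D i) with ha
    set b := Metric.infDist y (D i) with hb
    have ha0 : 0 ≤ a := Metric.infDist_nonneg
    rcases (show 0 ≤ b from Metric.infDist_nonneg).eq_or_lt with hb0 | hb0
    · right
      have ha1 : a = 0 := by linarith
      have hne : (D i).Nonempty := ⟨_, h.mem i⟩
      exact ⟨i, ((h.compact i).isClosed.mem_iff_infDist_zero hne).2 ha1,
        ((h.compact i).isClosed.mem_iff_infDist_zero hne).2 hb0.symm⟩
    · left
      have e2 : y = c i + (a / b) • (x - c i) := by
        have e3 : (b / ε) • (y - c i) = (a / ε) • (x - c i) := by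
          exact (add_left_cancel he).symm
        have e4 := congrArg (fun z => (ε / b) • z) e3
        simp only [smul_smul] at e4
        have e5 : ε / b * (b / ε) = 1 := by field_simp
        have e6 : ε / b * (a / ε) = a / b := by field_simp
        rw [e5, e6, one_smul] at e4
        rw [← e4]; abel
      have h1 : a / b ≤ 1 := by rw [div_le_one hb0]; exact hle
      have h2 := infDist_star (h.compact i) (h.mem i) (h.star i) x (div_nonneg ha0 hb0.le) h1
      rw [← e2, ← hb, ← ha, div_mul_eq_mul_div, le_div_iff₀ hb0] at h2
      have hab : a = b := by nlinarith
      rw [hab, div_self hb0.ne'] at e2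
      rw [e2]; simp
  by_cases hx : ∃ i, Metric.infDist x (D i) < ε
  · obtain ⟨i, hi⟩ := hx
    have h1 := h.nbhd hi
    by_cases hy : ∃ j, Metric.infDist y (D j) < ε
    · obtain ⟨j, hj⟩ := hy
      have h2 := h.nbhd hj
      rw [← hxy] at h2
      obtain rfl := h.sep i j _ h1 h2
      rcases le_total (Metric.infDist x (D i)) (Metric.infDist y (D i)) with hl | hl
      · exact aux x y i hi hj hl hxy
      · rcases aux y x i hj hi hl hxy.symm with h3 | ⟨k, h3, h4⟩
        · exact Or.inl h3.symm
        · exact Or.inr ⟨k, h4, h3⟩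
    · push Not at hy
      rw [hxy, h.off hy] at h1
      exact absurd h1 (not_lt.2 (hy i))
  · push Not at hx
    by_cases hy : ∃ j, Metric.infDist y (D j) < ε
    · obtain ⟨j, hj⟩ := hy
      have h2 := h.nbhd hj
      rw [← hxy, h.off hx] at h2
      exact absurd h2 (not_lt.2 (hx j))
    · push Not at hy
      rw [h.off hx, h.off hy] at hxy
      exact Or.inl hxy

theorem disj_eventually {A B : Set E} (hA : IsCompact A) (hB : IsClosed B) (hAB : Disjoint A B)
    (hA' : A.Nonempty) (hB' : B.Nonempty) :
    ∀ᶠ ε in 𝓝[>] (0 : ℝ), ∀ x, Metric.infDist x A < ε → ε ≤ Metric.infDist x B := by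
  obtain ⟨δ, hδ, h⟩ := hAB.exists_thickenings hA hB
  filter_upwards [Ioo_mem_nhdsGT hδ] with ε hε x hx
  by_contra hlt
  push Not at hlt
  exact Set.disjoint_left.1 h
    ((Metric.mem_thickening_iff_infDist_lt hA').2 (hx.trans hε.2))
    ((Metric.mem_thickening_iff_infDist_lt hB').2 (hlt.trans hε.2))

theorem starFam_eventually (hc : ∀ i, IsCompact (D i)) (hm : ∀ i, c i ∈ D i)
    (hs : ∀ i, StarConvex ℝ (c i) (D i)) (hd : ∀ i j, i ≠ j → Disjoint (D i) (D j)) :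
    ∀ᶠ ε in 𝓝[>] (0 : ℝ), StarFam D c ε := by
  have h1 : ∀ᶠ ε in 𝓝[>] (0 : ℝ), ∀ i j, i ≠ j → ∀ x, Metric.infDist x (D i) < ε →
      ε ≤ Metric.infDist x (D j) := by
    rw [Filter.eventually_all]; intro i
    rw [Filter.eventually_all]; intro j
    by_cases hij : i = j
    · simp [hij]
    · filter_upwards [disj_eventually (hc i) (hc j).isClosed (hd i j hij) ⟨_, hm i⟩ ⟨_, hm j⟩]
        with ε hε _ using hε
  filter_upwards [h1, self_mem_nhdsWithin] with ε hε hpos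
  refine ⟨hpos, hc, hm, hs, fun i j x hi hj => ?_⟩
  by_contra hij
  exact absurd hj (not_lt.2 (hε i j hij x hi))

end Collapse

open Set MeasureTheory Topology Module


section Simp
set_option linter.unusedSectionVars false
open Geometry

variable {V : Type*} [NormedAddCommGroup V] [NormedSpace ℝ V] [FiniteDimensional ℝ V]
  {K : Geometry.SimplicialComplex ℝ V}

theorem face_inter [DecidableEq V] {s t : Finset V} (hs : s ∈ K.faces) (ht : t ∈ K.faces) {x : V}
    (hxs : x ∈ convexHull ℝ (s : Set V)) (hxt : x ∈ convexHull ℝ (t : Set V)) :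
    s ∩ t ∈ K.faces ∧ x ∈ convexHull ℝ ((s ∩ t : Finset V) : Set V) := by
  have h := K.inter_subset_convexHull hs ht ⟨hxs, hxt⟩
  rw [← Finset.coe_inter] at h
  refine ⟨K.down_closed hs Finset.inter_subset_left ?_, h⟩
  rw [← Finset.coe_nonempty]
  exact convexHull_nonempty_iff.1 ⟨x, h⟩

theorem supp_exists {x : V} (hx : x ∈ K.space) :
    ∃ s ∈ K.faces, x ∈ convexHull ℝ (s : Set V) ∧
      ∀ t ∈ K.faces, x ∈ convexHull ℝ (t : Set V) → s ⊆ t := by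
  classical
  obtain ⟨s0, hs0, hx0⟩ := SimplicialComplex.mem_space_iff.1 hx
  have hP : ∃ k : ℕ, ∃ s ∈ K.faces, x ∈ convexHull ℝ (s : Set V) ∧ s.card = k :=
    ⟨_, s0, hs0, hx0, rfl⟩
  obtain ⟨s, hs, hxs, hk⟩ := Nat.find_spec hP
  refine ⟨s, hs, hxs, fun t ht hxt => ?_⟩
  obtain ⟨h1, h2⟩ := face_inter hs ht hxs hxt
  have h3 := Nat.find_min' hP ⟨s ∩ t, h1, h2, rfl⟩
  have h4 : s ∩ t = s := Finset.eq_of_subset_of_card_le Finset.inter_subset_left (by omega)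
  exact Finset.inter_eq_left.1 h4

theorem mem_intrinsic_of_supp {s : Finset V} {x : V} (hx : x ∈ convexHull ℝ (s : Set V))
    (hmin : ∀ t ⊂ s, x ∉ convexHull ℝ (t : Set V)) :
    x ∈ intrinsicInterior ℝ (convexHull ℝ (s : Set V)) := by
  classical
  have hne : (convexHull ℝ (s : Set V)).Nonempty := ⟨x, hx⟩
  obtain ⟨y0, hy0⟩ := hne.intrinsicInterior (convex_convexHull ℝ _)
  obtain ⟨w, hw0, hw1, hwx⟩ := Finset.mem_convexHull'.1 hx
  obtain ⟨u, hu0, hu1, huy⟩ := Finset.mem_convexHull'.1 (intrinsicInterior_subset hy0)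
  have hpos : ∀ y ∈ s, 0 < w y := by
    intro y hy
    rcases (hw0 y hy).eq_or_lt with h | h
    · exfalso
      refine hmin (s.erase y) (Finset.erase_ssubset hy) (Finset.mem_convexHull'.2
        ⟨w, fun z hz => hw0 z (Finset.mem_of_mem_erase hz), ?_, ?_⟩)
      · rw [← hw1, ← Finset.add_sum_erase s w hy, ← h, zero_add]
      · rw [← hwx, ← Finset.add_sum_erase s (fun y => w y • y) hy, ← h, zero_smul, zero_add]
    · exact h
  have hev : ∀ᶠ e in 𝓝[>] (0 : ℝ), ∀ y ∈ s, e * u y < w y := by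
    rw [Filter.eventually_all_finset]
    intro y hy
    have : Filter.Tendsto (fun e : ℝ => e * u y) (𝓝[>] 0) (𝓝 0) := by
      have : Continuous (fun e : ℝ => e * u y) := by fun_prop
      simpa using (this.tendsto 0).mono_left nhdsWithin_le_nhds
    exact this.eventually_lt_const (hpos y hy)
  obtain ⟨e, he, he0, he1⟩ := (hev.and (Ioo_mem_nhdsGT (show (0 : ℝ) < 1 by norm_num))).exists
  have h1e : 0 < 1 - e := by linarith
  let z : V := (1 - e)⁻¹ • (x - e • y0)
  have hz : z ∈ convexHull ℝ (s : Set V) := by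
    refine Finset.mem_convexHull'.2 ⟨fun y => (1 - e)⁻¹ * (w y - e * u y), ?_, ?_, ?_⟩
    · intro y hy
      have := he y hy
      exact mul_nonneg (inv_nonneg.2 h1e.le) (by linarith)
    · rw [← Finset.mul_sum, Finset.sum_sub_distrib, ← Finset.mul_sum, hw1, hu1, mul_one]
      exact inv_mul_cancel₀ h1e.ne'
    · simp only [z, ← hwx, ← huy, Finset.smul_sum, ← Finset.sum_sub_distrib]
      refine Finset.sum_congr rfl fun y _ => ?_
      module
  rw [mem_intrinsicInterior] at hy0 ⊢
  obtain ⟨y0', hy0', rfl⟩ := hy0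
  have hsub : convexHull ℝ (s : Set V) ⊆ affineSpan ℝ (convexHull ℝ (s : Set V)) :=
    subset_affineSpan ℝ _
  refine ⟨⟨x, hsub hx⟩, ?_, rfl⟩
  have hxz : x = (1 - e) • z + e • (y0' : V) := by
    simp only [z, smul_smul, mul_inv_cancel₀ h1e.ne']
    module
  clear_value z
  let φ : affineSpan ℝ (convexHull ℝ (s : Set V)) → affineSpan ℝ (convexHull ℝ (s : Set V)) := fun y => ⟨AffineMap.lineMap z (y : V) e⁻¹,
    AffineMap.lineMap_mem _ (hsub hz) y.2⟩
  have hφ : Continuous φ := by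
    refine Continuous.subtype_mk ?_ _
    simp only [AffineMap.lineMap_apply_module]
    fun_prop
  have hφx : φ ⟨x, hsub hx⟩ = y0' := by
    apply Subtype.ext
    simp only [φ, AffineMap.lineMap_apply_module]
    rw [hxz, smul_add, smul_smul, smul_smul, inv_mul_cancel₀ he0.ne']
    have h3 : e⁻¹ * (1 - e) = e⁻¹ - 1 := by field_simp
    rw [h3]
    module
  rw [mem_interior_iff_mem_nhds] at hy0' ⊢
  rw [← hφx] at hy0'
  filter_upwards [hφ.continuousAt.preimage_mem_nhds hy0'] with y hy
  have hy' : (φ y : V) ∈ convexHull ℝ (s : Set V) := hy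
  have := convex_convexHull ℝ (s : Set V) hz hy' h1e.le he0.le (by ring)
  rw [Set.mem_preimage]
  convert this using 1
  simp only [φ, AffineMap.lineMap_apply_module, smul_add, smul_smul, mul_inv_cancel₀ he0.ne']
  have h4 : e * (1 - e⁻¹) = e - 1 := by field_simp
  rw [h4]
  module

theorem cone_decomp [DecidableEq V] {s : Finset V} {v x : V} (hv : v ∈ s)
    (hx : x ∈ convexHull ℝ (s : Set V)) :
    x = v ∨ ∃ p ∈ convexHull ℝ ((s.erase v : Finset V) : Set V), ∃ b ∈ Icc (0 : ℝ) 1,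
      x = v + b • (p - v) := by
  rcases (s.erase v).eq_empty_or_nonempty with h | h
  · left
    rw [← Finset.insert_erase hv, h] at hx
    simpa using hx
  · right
    rw [← Finset.insert_erase hv, Finset.coe_insert,
      convexHull_insert (Finset.coe_nonempty.2 h), mem_convexJoin] at hx
    obtain ⟨y, hy, p, hp, hxp⟩ := hx
    obtain rfl : y = v := hy
    rw [segment_eq_image'] at hxp
    obtain ⟨b, hb, rfl⟩ := hxp
    exact ⟨p, hp, b, hb, rfl⟩

theorem star_notMem [DecidableEq V] {t : Finset V} (ht : AffineIndependent ℝ ((↑) : t → V))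
    {v x : V} (hv : v ∈ t) (hx : x ∈ convexHull ℝ (t : Set V))
    (hx' : x ∉ convexHull ℝ ((t.erase v : Finset V) : Set V)) {l : ℝ} (hl : l ∈ Icc (0 : ℝ) 1) :
    v + l • (x - v) ∉ affineSpan ℝ ((t.erase v : Finset V) : Set V) := by
  have hvt : v ∉ affineSpan ℝ ((t.erase v : Finset V) : Set V) := by
    have := ht.notMem_affineSpan_sdiff ⟨v, hv⟩ Set.univ
    convert this using 3
    ext y
    simp [and_comm]
  intro hP
  rcases cone_decomp hv hx with rfl | ⟨p, hp, b, hb, rfl⟩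
  · rw [sub_self, smul_zero, add_zero] at hP; exact hvt hP
  · have hb1 : b ≠ 1 := by
      rintro rfl
      apply hx'; simpa using hp
    have hb2 : b < 1 := lt_of_le_of_ne hb.2 hb1
    have hlb : l * b < 1 := by
      have := mul_le_of_le_one_left hb.1 hl.2
      linarith
    have hpA := convexHull_subset_affineSpan (𝕜 := ℝ) _ hp
    have h := AffineMap.lineMap_mem ((1 - l * b)⁻¹) hpA hP
    apply hvt
    convert h using 1
    simp only [AffineMap.lineMap_apply_module]
    have h1 : 1 - l * b ≠ 0 := by linarith
    have : v + l • (v + b • (p - v) - v) = (1 - l * b) • v + (l * b) • p := by module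
    rw [this, smul_add, smul_smul, smul_smul, inv_mul_cancel₀ h1]
    have h3 : 1 - (1 - l * b)⁻¹ + (1 - l * b)⁻¹ * (l * b) = 0 := by field_simp; ring
    calc v = v + (1 - (1 - l * b)⁻¹ + (1 - l * b)⁻¹ * (l * b)) • p := by rw [h3]; simp
      _ = _ := by module

theorem finrank_face {s : Finset V} {m : ℕ} (h : s.card ≤ m + 1) :
    finrank ℝ (vectorSpan ℝ (s : Set V)) ≤ m := by
  classical
  rcases s.eq_empty_or_nonempty with rfl | hs
  · rw [Finset.coe_empty, vectorSpan_empty, finrank_bot]; omega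
  · have h2 := finrank_vectorSpan_image_finset_le ℝ (fun x : V => x) s (n := s.card - 1)
      (by have := hs.card_pos; omega)
    have h3 : s.image (fun x : V => x) = s := Finset.image_id'
    rw [h3] at h2
    omega

theorem sub_mem_face {s : Finset V} {x y : V} (hx : x ∈ convexHull ℝ (s : Set V))
    (hy : y ∈ convexHull ℝ (s : Set V)) : x - y ∈ vectorSpan ℝ (s : Set V) := by
  rw [← direction_affineSpan]
  exact AffineSubspace.vsub_mem_direction (convexHull_subset_affineSpan (𝕜 := ℝ) _ hx)
    (convexHull_subset_affineSpan (𝕜 := ℝ) _ hy)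

theorem hull_compact (s : Finset V) : IsCompact (convexHull ℝ (s : Set V)) :=
  s.finite_toSet.isCompact_convexHull ℝ

theorem space_compact (hK : K.faces.Finite) : IsCompact K.space := by
  unfold SimplicialComplex.space
  exact hK.isCompact_biUnion fun s _ => hull_compact s

end Simp

open Set MeasureTheory Topology Module


section Map
set_option linter.unusedSectionVars false
open Geometry
variable {n d : ℕ} {K : Geometry.SimplicialComplex ℝ (EuclideanSpace ℝ (Fin n))}

theorem supportFace_exists {x : EuclideanSpace ℝ (Fin n)}
    {s : Finset (EuclideanSpace ℝ (Fin n))} (hs : s ∈ K.faces)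
    (hx : x ∈ convexHull ℝ (s : Set (EuclideanSpace ℝ (Fin n)))) :
    ∃ t ⊆ s, IsSupportFace K x t := by
  obtain ⟨t, ht, hxt, hmin⟩ := supp_exists (SimplicialComplex.convexHull_subset_space hs hx)
  refine ⟨t, hmin s hs hx, ht, mem_intrinsic_of_supp hxt ?_⟩
  intro r hr hxr
  have hne : r.Nonempty := by
    rw [← Finset.coe_nonempty]; exact convexHull_nonempty_iff.1 ⟨x, hxr⟩
  exact hr.2 (hmin r (K.down_closed ht hr.1 hne) hxr)

theorem tverberg_ne {f : EuclideanSpace ℝ (Fin n) → EuclideanSpace ℝ (Fin d)}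
    (hT : ¬ HasTverbergPoint K 2 f) {s t : Finset (EuclideanSpace ℝ (Fin n))}
    (hs : s ∈ K.faces) (ht : t ∈ K.faces) (hst : Disjoint s t) {x y : EuclideanSpace ℝ (Fin n)}
    (hx : x ∈ convexHull ℝ (s : Set (EuclideanSpace ℝ (Fin n))))
    (hy : y ∈ convexHull ℝ (t : Set (EuclideanSpace ℝ (Fin n)))) : f x ≠ f y := by
  intro h
  obtain ⟨s', hs', hsx⟩ := supportFace_exists hs hx
  obtain ⟨t', ht', hty⟩ := supportFace_exists ht hy
  have hd : Disjoint s' t' := hst.mono hs' ht'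
  apply hT
  refine ⟨![x, y], ![s', t'], ?_, ?_, ?_⟩
  · intro i; fin_cases i
    · exact hsx
    · exact hty
  · intro i j hij
    fin_cases i <;> fin_cases j
    · exact absurd rfl hij
    · exact hd
    · exact hd.symm
    · exact absurd rfl hij
  · intro i j
    fin_cases i <;> fin_cases j <;> simp [h]

theorem tverberg_delta (hK : K.faces.Finite)
    {f : EuclideanSpace ℝ (Fin n) → EuclideanSpace ℝ (Fin d)}
    (hf : ContinuousOn f K.space) (hT : ¬ HasTverbergPoint K 2 f) :
    ∃ δ > 0, ∀ s ∈ K.faces, ∀ t ∈ K.faces, Disjoint s t →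
      ∀ x ∈ convexHull ℝ (s : Set (EuclideanSpace ℝ (Fin n))),
      ∀ y ∈ convexHull ℝ (t : Set (EuclideanSpace ℝ (Fin n))), δ ≤ dist (f x) (f y) := by
  have h : ∀ᶠ δ in 𝓝[>] (0 : ℝ), ∀ s ∈ K.faces, ∀ t ∈ K.faces, Disjoint s t →
      ∀ x ∈ convexHull ℝ (s : Set (EuclideanSpace ℝ (Fin n))),
      ∀ y ∈ convexHull ℝ (t : Set (EuclideanSpace ℝ (Fin n))), δ ≤ dist (f x) (f y) := by
    rw [Filter.eventually_all_finite hK]; intro s hs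
    rw [Filter.eventually_all_finite hK]; intro t ht
    by_cases hst : Disjoint s t
    · have hcs : IsCompact (f '' convexHull ℝ (s : Set (EuclideanSpace ℝ (Fin n)))) :=
        (hull_compact s).image_of_continuousOn
          (hf.mono (SimplicialComplex.convexHull_subset_space hs))
      have hct : IsCompact (f '' convexHull ℝ (t : Set (EuclideanSpace ℝ (Fin n)))) :=
        (hull_compact t).image_of_continuousOn
          (hf.mono (SimplicialComplex.convexHull_subset_space ht))
      have hd : Disjoint (f '' convexHull ℝ (s : Set (EuclideanSpace ℝ (Fin n))))
          (f '' convexHull ℝ (t : Set (EuclideanSpace ℝ (Fin n)))) := by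
        rw [Set.disjoint_left]
        rintro _ ⟨x, hx, rfl⟩ ⟨y, hy, hxy⟩
        exact tverberg_ne hT hs ht hst hx hy hxy.symm
      have hn : ∀ r ∈ K.faces,
          (f '' convexHull ℝ (r : Set (EuclideanSpace ℝ (Fin n)))).Nonempty := fun r hr =>
        (convexHull_nonempty_iff.2 (Finset.coe_nonempty.2
          (SimplicialComplex.nonempty_of_mem_faces hr))).image f
      filter_upwards [disj_eventually hcs hct.isClosed hd (hn s hs) (hn t ht),
        self_mem_nhdsWithin] with δ h1 h2 _ x hx y hy
      have h3 := h1 (f x) (by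
        rw [Metric.infDist_zero_of_mem (mem_image_of_mem f hx)]; exact h2)
      exact h3.trans (Metric.infDist_le_dist_of_mem (mem_image_of_mem f hy))
    · exact Filter.Eventually.of_forall fun δ h => absurd h hst
  obtain ⟨δ, h1, h2⟩ := (h.and self_mem_nhdsWithin).exists
  exact ⟨δ, h2, h1⟩

theorem smooth_approx {S : Set (EuclideanSpace ℝ (Fin n))} (hS : IsClosed S)
    {f : EuclideanSpace ℝ (Fin n) → EuclideanSpace ℝ (Fin d)}
    (hf : ContinuousOn f S) {ε : ℝ} (hε : 0 < ε) :
    ∃ F : EuclideanSpace ℝ (Fin n) → EuclideanSpace ℝ (Fin d), ContDiff ℝ 2 F ∧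
      ∀ x ∈ S, dist (F x) (f x) < ε := by
  haveI : TietzeExtension.{0, 0} (EuclideanSpace ℝ (Fin d)) := TietzeExtension.of_tvs ℝ
  obtain ⟨g, hg⟩ := ContinuousMap.exists_restrict_eq hS
    (⟨S.restrict f, hf.restrict⟩ : C(S, EuclideanSpace ℝ (Fin d)))
  obtain ⟨F, hF, hFd, -⟩ := g.continuous.exists_contDiff_approx 2
    (continuous_const (y := ε)) (fun _ => hε)
  refine ⟨F, by exact_mod_cast hF, fun x hx => ?_⟩
  have h1 : g x = f x := congrArg (fun h => h ⟨x, hx⟩) hg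
  rw [← h1]
  exact hFd x

theorem exists_pert {P : PertW n (EuclideanSpace ℝ (Fin d)) → Prop}
    (hP : ∀ᵐ w : PertW n (EuclideanSpace ℝ (Fin d)), P w)
    {S : Set (EuclideanSpace ℝ (Fin n))} (hS : IsCompact S) {ε : ℝ} (hε : 0 < ε) :
    ∃ w, P w ∧ ∀ x ∈ S, ‖(pertLam x w : EuclideanSpace ℝ (Fin d))‖ < ε := by
  have hcont := (contDiff_pertLam (N := 0) (n := n) (E := EuclideanSpace ℝ (Fin d))).continuous
  obtain ⟨C, hC⟩ := hS.exists_bound_of_continuousOn hcont.continuousOn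
  have hpos : 0 < ε / (|C| + 1) := by positivity
  obtain ⟨w, hw, hPw⟩ := (Measure.dense_of_ae hP).inter_nhds_nonempty
    (Metric.ball_mem_nhds (0 : PertW n (EuclideanSpace ℝ (Fin d))) hpos)
  refine ⟨w, ?_, ?_⟩
  · first | exact hPw | exact hw
  · intro x hx
    have hw' : ‖w‖ < ε / (|C| + 1) := by
      first | simpa using hw | simpa using hPw
    calc ‖(pertLam x w : EuclideanSpace ℝ (Fin d))‖
        ≤ ‖(pertLam x : PertW n (EuclideanSpace ℝ (Fin d)) →L[ℝ] _)‖ * ‖w‖ :=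
          ContinuousLinearMap.le_opNorm _ _
      _ ≤ (|C| + 1) * ‖w‖ := by
          gcongr
          have := hC x hx
          have := le_abs_self C
          linarith
      _ < ε := by
          rw [lt_div_iff₀ (by positivity)] at hw'
          linarith

/-- Generic maps. -/
structure GenericMap (K : Geometry.SimplicialComplex ℝ (EuclideanSpace ℝ (Fin n)))
    (G : EuclideanSpace ℝ (Fin n) → EuclideanSpace ℝ (Fin d)) : Prop where
  smooth : ContDiff ℝ 2 G
  almost : ∀ s ∈ K.faces, ∀ t ∈ K.faces, Disjoint s t →
      ∀ x ∈ convexHull ℝ (s : Set (EuclideanSpace ℝ (Fin n))),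
      ∀ y ∈ convexHull ℝ (t : Set (EuclideanSpace ℝ (Fin n))), G x ≠ G y
  double : ∀ s ∈ K.faces, ∀ t ∈ K.faces,
      ∀ x ∈ convexHull ℝ (s : Set (EuclideanSpace ℝ (Fin n))),
      ∀ y ∈ convexHull ℝ (t : Set (EuclideanSpace ℝ (Fin n))), x ≠ y → G x = G y →
      ∀ u ∈ vectorSpan ℝ (s : Set (EuclideanSpace ℝ (Fin n))),
      ∀ v ∈ vectorSpan ℝ (t : Set (EuclideanSpace ℝ (Fin n))),
      fderiv ℝ G x u = fderiv ℝ G y v → u = 0 ∧ v = 0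
  imm : ∀ s ∈ K.faces, ∀ t ∈ K.faces,
      ∀ x ∈ convexHull ℝ (s : Set (EuclideanSpace ℝ (Fin n))),
      x ∈ convexHull ℝ (t : Set (EuclideanSpace ℝ (Fin n))) →
      ∀ u ∈ vectorSpan ℝ (s : Set (EuclideanSpace ℝ (Fin n))) ⊔
        vectorSpan ℝ (t : Set (EuclideanSpace ℝ (Fin n))), fderiv ℝ G x u = 0 → u = 0
  triple : ∀ x ∈ K.space, ∀ y ∈ K.space, ∀ z ∈ K.space, x ≠ y → x ≠ z → z ≠ y →
      ¬ (G x = G y ∧ G z = G y)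
  seg : ∀ v ∈ K.vertices, ∀ w ∈ K.vertices, ∀ x ∈ K.space, ∀ x' ∈ K.space,
      ∀ y' ∈ K.space, ∀ a b : ℝ, ∀ y, y = w + a • (v - w) + b • (x - w) →
      x ≠ x' → x ≠ y → x ≠ y' → y ≠ x' → y ≠ y' → ¬ (G x = G x' ∧ G y = G y')

theorem vertices_finite (hK : K.faces.Finite) : K.vertices.Finite := by
  rw [SimplicialComplex.vertices_eq]
  exact hK.biUnion fun s _ => s.finite_toSet

theorem exists_generic {m : ℕ} (hm : 3 ≤ m) (hK : K.faces.Finite)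
    (hdim : ∀ s ∈ K.faces, s.card ≤ m + 1)
    {f : EuclideanSpace ℝ (Fin n) → EuclideanSpace ℝ (Fin (2 * m))}
    (hf : ContinuousOn f K.space) (hT : ¬ HasTverbergPoint K 2 f) :
    ∃ G : EuclideanSpace ℝ (Fin n) → EuclideanSpace ℝ (Fin (2 * m)), GenericMap K G := by
  obtain ⟨δ, hδ, hsep⟩ := tverberg_delta hK hf hT
  have hcpt := space_compact hK
  obtain ⟨F, hF, hFf⟩ := smooth_approx hcpt.isClosed hf (show 0 < δ / 4 by positivity)
  have hF1 : ContDiff ℝ 1 F := hF.of_le (by norm_num)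
  have hfr := fun s hs => finrank_face (hdim s hs)
  have hbase : ∀ s ∈ K.faces, ∃ p, p ∈ convexHull ℝ (s : Set (EuclideanSpace ℝ (Fin n))) := by
    intro s hs
    exact convexHull_nonempty_iff.2 (Finset.coe_nonempty.2
          (SimplicialComplex.nonempty_of_mem_faces hs))
  have hC := hK.countable
  have hVC := (vertices_finite hK).countable
  have aQ : ∀ᵐ w : PertW n (EuclideanSpace ℝ (Fin (2 * m))), ∀ s ∈ K.faces, ∀ t ∈ K.faces,
      ∀ x ∈ convexHull ℝ (s : Set (EuclideanSpace ℝ (Fin n))),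
      ∀ y ∈ convexHull ℝ (t : Set (EuclideanSpace ℝ (Fin n))), x ≠ y →
      pertG F w x = pertG F w y →
      ∀ u ∈ vectorSpan ℝ (s : Set (EuclideanSpace ℝ (Fin n))),
      ∀ v ∈ vectorSpan ℝ (t : Set (EuclideanSpace ℝ (Fin n))),
      fderiv ℝ (pertG F w) x u = fderiv ℝ (pertG F w) y v → u = 0 ∧ v = 0 := by
    rw [ae_ball_iff hC]; intro s hs
    rw [ae_ball_iff hC]; intro t ht
    obtain ⟨p, hp⟩ := hbase s hs
    obtain ⟨q, hq⟩ := hbase t ht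
    filter_upwards [generic_Q hF1 p q (vectorSpan ℝ (s : Set (EuclideanSpace ℝ (Fin n))))
        (vectorSpan ℝ (t : Set (EuclideanSpace ℝ (Fin n)))) (by have := hfr s hs; have := hfr t ht; omega)]
      with w hw x hx y hy hxy hG u hu v hv huv
    have := hw (x - p) (sub_mem_face hx hp) (y - q) (sub_mem_face hy hq)
    simp only [add_sub_cancel] at this
    exact this hxy hG u hu v hv huv
  have aP : ∀ᵐ w : PertW n (EuclideanSpace ℝ (Fin (2 * m))), ∀ s ∈ K.faces, ∀ t ∈ K.faces,
      ∀ x ∈ convexHull ℝ (s : Set (EuclideanSpace ℝ (Fin n))),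
      x ∈ convexHull ℝ (t : Set (EuclideanSpace ℝ (Fin n))) →
      ∀ u ∈ vectorSpan ℝ (s : Set (EuclideanSpace ℝ (Fin n))) ⊔
        vectorSpan ℝ (t : Set (EuclideanSpace ℝ (Fin n))),
        fderiv ℝ (pertG F w) x u = 0 → u = 0 := by
    rw [ae_ball_iff hC]; intro s hs
    rw [ae_ball_iff hC]; intro t ht
    by_cases hne : ∃ p, p ∈ convexHull ℝ (s : Set (EuclideanSpace ℝ (Fin n))) ∧
        p ∈ convexHull ℝ (t : Set (EuclideanSpace ℝ (Fin n)))
    · obtain ⟨p, hp, hq⟩ := hne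
      filter_upwards [generic_P hF p (vectorSpan ℝ (s : Set (EuclideanSpace ℝ (Fin n))))
        (vectorSpan ℝ (t : Set (EuclideanSpace ℝ (Fin n)))) (by have := hfr s hs; have := hfr t ht; omega)]
        with w hw x hx hy u hu hu0
      have := hw (x - p) ⟨sub_mem_face hx hp, sub_mem_face hy hq⟩
      simp only [add_sub_cancel] at this
      exact this u hu hu0
    · exact Filter.Eventually.of_forall fun w x hx hy => absurd ⟨x, hx, hy⟩ hne
  have aT : ∀ᵐ w : PertW n (EuclideanSpace ℝ (Fin (2 * m))), ∀ s ∈ K.faces, ∀ t ∈ K.faces,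
      ∀ r ∈ K.faces,
      ∀ x ∈ convexHull ℝ (s : Set (EuclideanSpace ℝ (Fin n))),
      ∀ y ∈ convexHull ℝ (t : Set (EuclideanSpace ℝ (Fin n))),
      ∀ z ∈ convexHull ℝ (r : Set (EuclideanSpace ℝ (Fin n))), x ≠ y → x ≠ z → z ≠ y →
      ¬ (pertG F w x = pertG F w y ∧ pertG F w z = pertG F w y) := by
    rw [ae_ball_iff hC]; intro s hs
    rw [ae_ball_iff hC]; intro t ht
    rw [ae_ball_iff hC]; intro r hr
    obtain ⟨p, hp⟩ := hbase s hs
    obtain ⟨q, hq⟩ := hbase t ht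
    obtain ⟨o, ho⟩ := hbase r hr
    let Ds := vectorSpan ℝ (s : Set (EuclideanSpace ℝ (Fin n)))
    let Dt := vectorSpan ℝ (t : Set (EuclideanSpace ℝ (Fin n)))
    let Dr := vectorSpan ℝ (r : Set (EuclideanSpace ℝ (Fin n)))
    have ha : ContDiff ℝ 1 (fun X : Ds × Dt × Dr => p + (X.1 : EuclideanSpace ℝ (Fin n))) :=
      contDiff_const.add (Ds.subtypeL.contDiff.comp contDiff_fst)
    have hb : ContDiff ℝ 1 (fun X : Ds × Dt × Dr => q + (X.2.1 : EuclideanSpace ℝ (Fin n))) :=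
      contDiff_const.add (Dt.subtypeL.contDiff.comp (contDiff_fst.comp contDiff_snd))
    have hc : ContDiff ℝ 1 (fun X : Ds × Dt × Dr => o + (X.2.2 : EuclideanSpace ℝ (Fin n))) :=
      contDiff_const.add (Dr.subtypeL.contDiff.comp (contDiff_snd.comp contDiff_snd))
    filter_upwards [generic_four hF1 (by
      have := hfr s hs; have := hfr t ht; have := hfr r hr
      rw [finrank_prod, finrank_prod]; simp only [Ds, Dt, Dr]; omega) ha hb hc hb]
      with w hw x hx y hy z hz h1 h2 h3
    have := hw (⟨x - p, sub_mem_face hx hp⟩, ⟨y - q, sub_mem_face hy hq⟩,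
      ⟨z - o, sub_mem_face hz ho⟩)
    simp only [add_sub_cancel] at this
    exact this h1 h2 h1 h3 h3
  have aS : ∀ᵐ w : PertW n (EuclideanSpace ℝ (Fin (2 * m))), ∀ v ∈ K.vertices,
      ∀ v' ∈ K.vertices, ∀ s ∈ K.faces, ∀ t ∈ K.faces, ∀ r ∈ K.faces,
      ∀ x ∈ convexHull ℝ (s : Set (EuclideanSpace ℝ (Fin n))),
      ∀ x' ∈ convexHull ℝ (t : Set (EuclideanSpace ℝ (Fin n))),
      ∀ y' ∈ convexHull ℝ (r : Set (EuclideanSpace ℝ (Fin n))),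
      ∀ a b : ℝ, ∀ y, y = v' + a • (v - v') + b • (x - v') →
      x ≠ x' → x ≠ y → x ≠ y' → y ≠ x' → y ≠ y' →
      ¬ (pertG F w x = pertG F w x' ∧ pertG F w y = pertG F w y') := by
    rw [ae_ball_iff hVC]; intro v hv
    rw [ae_ball_iff hVC]; intro v' hv'
    rw [ae_ball_iff hC]; intro s hs
    rw [ae_ball_iff hC]; intro t ht
    rw [ae_ball_iff hC]; intro r hr
    obtain ⟨p, hp⟩ := hbase s hs
    obtain ⟨q, hq⟩ := hbase t ht
    obtain ⟨o, ho⟩ := hbase r hr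
    let Ds := vectorSpan ℝ (s : Set (EuclideanSpace ℝ (Fin n)))
    let Dt := vectorSpan ℝ (t : Set (EuclideanSpace ℝ (Fin n)))
    let Dr := vectorSpan ℝ (r : Set (EuclideanSpace ℝ (Fin n)))
    have ha : ContDiff ℝ 1 (fun X : (Ds × Dt × Dr) × (ℝ × ℝ) =>
        p + (X.1.1 : EuclideanSpace ℝ (Fin n))) :=
      contDiff_const.add (Ds.subtypeL.contDiff.comp (contDiff_fst.comp contDiff_fst))
    have hb : ContDiff ℝ 1 (fun X : (Ds × Dt × Dr) × (ℝ × ℝ) =>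
        q + (X.1.2.1 : EuclideanSpace ℝ (Fin n))) :=
      contDiff_const.add (Dt.subtypeL.contDiff.comp
        (contDiff_fst.comp (contDiff_snd.comp contDiff_fst)))
    have hc : ContDiff ℝ 1 (fun X : (Ds × Dt × Dr) × (ℝ × ℝ) =>
        o + (X.1.2.2 : EuclideanSpace ℝ (Fin n))) :=
      contDiff_const.add (Dr.subtypeL.contDiff.comp
        (contDiff_snd.comp (contDiff_snd.comp contDiff_fst)))
    have hy : ContDiff ℝ 1 (fun X : (Ds × Dt × Dr) × (ℝ × ℝ) =>
        v' + X.2.1 • (v - v') + X.2.2 • ((p + (X.1.1 : EuclideanSpace ℝ (Fin n))) - v')) :=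
      (contDiff_const.add ((contDiff_fst.comp contDiff_snd).smul contDiff_const)).add
        ((contDiff_snd.comp contDiff_snd).smul (ha.sub contDiff_const))
    filter_upwards [generic_four hF1 (by
      have := hfr s hs; have := hfr t ht; have := hfr r hr
      rw [finrank_prod, finrank_prod, finrank_prod, finrank_prod, finrank_self]
      simp only [Ds, Dt, Dr]; omega) ha hb hy hc]
      with w hw x hx x' hx' y' hy' a b y hyd h1 h2 h3 h4 h5
    have := hw ((⟨x - p, sub_mem_face hx hp⟩, ⟨x' - q, sub_mem_face hx' hq⟩,
      ⟨y' - o, sub_mem_face hy' ho⟩), (a, b))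
    simp only [add_sub_cancel, ← hyd] at this
    exact this h1 h2 h3 h4 h5
  obtain ⟨w, ⟨hwQ, hwP, hwT, hwS⟩, hsmall⟩ := exists_pert
    (aQ.and (aP.and (aT.and aS))) hcpt (show 0 < δ / 4 by positivity)
  refine ⟨pertG F w, contDiff_pertG hF w, ?_, hwQ, hwP, ?_, ?_⟩
  · intro s hs t ht hst x hx y hy h
    have hx' := SimplicialComplex.convexHull_subset_space hs hx
    have hy' := SimplicialComplex.convexHull_subset_space ht hy
    have key : ∀ z ∈ K.space, dist (pertG F w z) (f z) < δ / 2 := by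
      intro z hz
      have h1 := hFf z hz
      have h2 := hsmall z hz
      calc dist (pertG F w z) (f z) ≤ dist (pertG F w z) (F z) + dist (F z) (f z) :=
            dist_triangle _ _ _
        _ < δ / 4 + δ / 4 := by
            refine add_lt_add ?_ h1
            rw [dist_eq_norm, pertG, add_sub_cancel_left]; exact h2
        _ = δ / 2 := by ring
    have h1 := hsep s hs t ht hst x hx y hy
    have h2 := key x hx'
    have h3 := key y hy'
    have h4 := dist_triangle_left (f x) (f y) (pertG F w x)
    rw [h] at h2 h4
    linarith
  · intro x hx y hy z hz
    obtain ⟨s, hs, hxs⟩ := SimplicialComplex.mem_space_iff.1 hx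
    obtain ⟨t, ht, hyt⟩ := SimplicialComplex.mem_space_iff.1 hy
    obtain ⟨r, hr, hzr⟩ := SimplicialComplex.mem_space_iff.1 hz
    exact hwT s hs t ht r hr x hxs y hyt z hzr
  · intro v hv v' hv' x hx y hy z hz
    obtain ⟨s, hs, hxs⟩ := SimplicialComplex.mem_space_iff.1 hx
    obtain ⟨t, ht, hyt⟩ := SimplicialComplex.mem_space_iff.1 hy
    obtain ⟨r, hr, hzr⟩ := SimplicialComplex.mem_space_iff.1 hz
    exact hwS v hv v' hv' s hs t ht r hr x hxs y hyt z hzr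

end Map

open Set MeasureTheory Topology Module


section Fin
set_option linter.unusedSectionVars false
open Geometry

theorem locInj {X E : Type*} [NormedAddCommGroup X] [NormedSpace ℝ X] [FiniteDimensional ℝ X]
    [NormedAddCommGroup E] [NormedSpace ℝ E] {H : X → E} {T : X →L[ℝ] E} {x : X}
    (h : HasStrictFDerivAt H T x) (hT : ∀ v, T v = 0 → v = 0) :
    ∃ r > 0, InjOn H (Metric.ball x r) := by
  obtain ⟨k, hk, hl⟩ := (T : X →ₗ[ℝ] E).exists_antilipschitzWith
    (LinearMap.ker_eq_bot'.2 hT)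
  obtain ⟨s, hs, ha⟩ := h.approximates_deriv_on_nhds (c := (2 * k)⁻¹) (Or.inr (by positivity))
  obtain ⟨r, hr, hrs⟩ := Metric.mem_nhds_iff.1 hs
  refine ⟨r, hr, fun y hy z hz hyz => ?_⟩
  have h1 := ha y (hrs hy) z (hrs hz)
  rw [hyz, sub_self, zero_sub, norm_neg] at h1
  have h2 := hl.le_mul_dist y z
  have h3 : dist ((T : X →ₗ[ℝ] E) y) ((T : X →ₗ[ℝ] E) z) = ‖T (y - z)‖ := by
    rw [dist_eq_norm, ← map_sub]; rfl
  rw [h3, dist_eq_norm] at h2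
  have hk' : (0 : ℝ) < k := hk
  have h4 : (((2 * k)⁻¹ : NNReal) : ℝ) = (2 * (k : ℝ))⁻¹ := by push_cast; rfl
  rw [h4] at h1
  have h5 : ‖y - z‖ ≤ (1 / 2) * ‖y - z‖ := by
    calc ‖y - z‖ ≤ k * ‖T (y - z)‖ := h2
      _ ≤ k * ((2 * (k : ℝ))⁻¹ * ‖y - z‖) := by gcongr
      _ = (1 / 2) * ‖y - z‖ := by field_simp
  have h6 : ‖y - z‖ ≤ 0 := by linarith
  exact sub_eq_zero.1 (norm_le_zero_iff.1 h6)

variable {n d : ℕ} {K : Geometry.SimplicialComplex ℝ (EuclideanSpace ℝ (Fin n))}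
  {G : EuclideanSpace ℝ (Fin n) → EuclideanSpace ℝ (Fin d)}

set_option maxHeartbeats 1000000 in
theorem GenericMap.finite_pair (hG : GenericMap K G) {s t : Finset (EuclideanSpace ℝ (Fin n))}
    (hs : s ∈ K.faces) (ht : t ∈ K.faces) :
    {p : EuclideanSpace ℝ (Fin n) × EuclideanSpace ℝ (Fin n) |
      p ∈ convexHull ℝ (s : Set (EuclideanSpace ℝ (Fin n))) ×ˢ
        convexHull ℝ (t : Set (EuclideanSpace ℝ (Fin n))) ∧
      p.1 ≠ p.2 ∧ G p.1 = G p.2}.Finite := by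
  set C := convexHull ℝ (s : Set (EuclideanSpace ℝ (Fin n))) ×ˢ
        convexHull ℝ (t : Set (EuclideanSpace ℝ (Fin n))) with hC
  set Z := {p : EuclideanSpace ℝ (Fin n) × EuclideanSpace ℝ (Fin n) | p ∈ C ∧
      p.1 ≠ p.2 ∧ G p.1 = G p.2} with hZ
  have hcpt : IsCompact C := (hull_compact s).prod (hull_compact t)
  have hsm := hG.smooth
  have hstrict : ∀ x, HasStrictFDerivAt G (fderiv ℝ G x) x := fun x =>
    hsm.contDiffAt.hasStrictFDerivAt (by norm_num)
  let D := vectorSpan ℝ (s : Set (EuclideanSpace ℝ (Fin n)))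
  let D' := vectorSpan ℝ (t : Set (EuclideanSpace ℝ (Fin n)))
  have key : (Z ∩ C).Finite := by
    refine hcpt.induction_on (p := fun A => (Z ∩ A).Finite) (by simp)
      (fun A B hAB hB => hB.subset (inter_subset_inter_right _ hAB))
      (fun A B hA hB => by
        show (Z ∩ (A ∪ B)).Finite
        rw [inter_union_distrib_left]; exact hA.union hB) ?_
    rintro ⟨x, y⟩ ⟨hx, hy⟩
    simp only at hx hy
    by_cases hxy : G x = G y
    · by_cases hne : x = y
      · subst hne
        let H : ↥(D ⊔ D') → EuclideanSpace ℝ (Fin d) := fun u => G (x + u)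
        have hH : HasStrictFDerivAt H ((fderiv ℝ G x).comp (D ⊔ D').subtypeL) 0 := by
          have k1 : HasStrictFDerivAt (fun u : ↥(D ⊔ D') => x + (u : EuclideanSpace ℝ (Fin n)))
            (D ⊔ D').subtypeL 0 := ((D ⊔ D').subtypeL.hasStrictFDerivAt).const_add x
          have k2 : HasStrictFDerivAt G (fderiv ℝ G x)
            (x + ((0 : ↥(D ⊔ D')) : EuclideanSpace ℝ (Fin n))) := by simpa using hstrict x
          exact HasStrictFDerivAt.comp (0 : ↥(D ⊔ D')) k2 k1
        obtain ⟨r, hr, hinj⟩ := locInj hH (by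
          intro v hv
          apply Subtype.ext
          exact hG.imm s hs t ht x hx hy v v.2 hv)
        refine ⟨Metric.ball (x, x) r ∩ C, Filter.inter_mem (mem_nhdsWithin_of_mem_nhds (Metric.ball_mem_nhds _ hr)) self_mem_nhdsWithin, ?_⟩
        convert Set.finite_empty
        rw [Set.eq_empty_iff_forall_notMem]
        rintro ⟨a, b⟩ ⟨⟨hab, hane, hG'⟩, hball, -⟩
        rw [Metric.mem_ball, Prod.dist_eq, max_lt_iff] at hball
        have ha : a - x ∈ D ⊔ D' := (le_sup_left : D ≤ D ⊔ D') (sub_mem_face hab.1 hx)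
        have hb : b - x ∈ D ⊔ D' := (le_sup_right : D' ≤ D ⊔ D') (sub_mem_face hab.2 hy)
        have := hinj (x₁ := ⟨a - x, ha⟩) (x₂ := ⟨b - x, hb⟩)
          (by rw [mem_ball_zero_iff, Submodule.coe_norm]; rw [dist_eq_norm] at hball; exact hball.1)
          (by
            rw [mem_ball_zero_iff, Submodule.coe_norm]
            rw [dist_eq_norm, dist_eq_norm] at hball; exact hball.2)
          (by simpa [H] using hG')
        apply hane
        have := congrArg Subtype.val this
        simpa using this
      · let H : D × D' → EuclideanSpace ℝ (Fin d) := fun u => G (x + u.1) - G (y + u.2)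
        have hH : HasStrictFDerivAt H
            ((fderiv ℝ G x).comp (D.subtypeL.comp (ContinuousLinearMap.fst ℝ D D')) -
            (fderiv ℝ G y).comp (D'.subtypeL.comp (ContinuousLinearMap.snd ℝ D D'))) 0 := by
          have k1 : HasStrictFDerivAt (fun u : D × D' => x + (u.1 : EuclideanSpace ℝ (Fin n)))
            (D.subtypeL.comp (ContinuousLinearMap.fst ℝ D D')) 0 :=
            ((D.subtypeL.comp (ContinuousLinearMap.fst ℝ D D')).hasStrictFDerivAt).const_add x
          have k2 : HasStrictFDerivAt (fun u : D × D' => y + (u.2 : EuclideanSpace ℝ (Fin n)))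
            (D'.subtypeL.comp (ContinuousLinearMap.snd ℝ D D')) 0 :=
            ((D'.subtypeL.comp (ContinuousLinearMap.snd ℝ D D')).hasStrictFDerivAt).const_add y
          have k3 : HasStrictFDerivAt G (fderiv ℝ G x)
            (x + ((0 : D × D').1 : EuclideanSpace ℝ (Fin n))) := by simpa using hstrict x
          have k4 : HasStrictFDerivAt G (fderiv ℝ G y)
            (y + ((0 : D × D').2 : EuclideanSpace ℝ (Fin n))) := by simpa using hstrict y
          exact HasStrictFDerivAt.sub (HasStrictFDerivAt.comp (0 : D × D') k3 k1)
            (HasStrictFDerivAt.comp (0 : D × D') k4 k2)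
        obtain ⟨r, hr, hinj⟩ := locInj hH (by
          rintro ⟨u, v⟩ huv
          have h1 := hG.double s hs t ht x hx y hy hne hxy u u.2 v v.2
            (by simpa [sub_eq_zero] using huv)
          exact Prod.ext (Subtype.ext h1.1) (Subtype.ext h1.2))
        refine ⟨Metric.ball (x, y) r ∩ C, Filter.inter_mem (mem_nhdsWithin_of_mem_nhds (Metric.ball_mem_nhds _ hr)) self_mem_nhdsWithin, ?_⟩
        refine (Set.finite_singleton (x, y)).subset ?_
        rintro ⟨a, b⟩ ⟨⟨hab, hane, hG'⟩, hball, -⟩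
        rw [Metric.mem_ball, Prod.dist_eq, max_lt_iff] at hball
        have ha : a - x ∈ D := sub_mem_face hab.1 hx
        have hb : b - y ∈ D' := sub_mem_face hab.2 hy
        have := hinj (x₁ := (⟨a - x, ha⟩, ⟨b - y, hb⟩)) (x₂ := 0)
          (by
            rw [mem_ball_zero_iff, Prod.norm_def, max_lt_iff, Submodule.coe_norm,
              Submodule.coe_norm]
            rw [dist_eq_norm, dist_eq_norm] at hball; exact hball)
          (by simpa using hr)
          (by
            simp only at hG'
            simp [H, hG', hxy])
        rw [Prod.ext_iff] at this
        have h1 := congrArg Subtype.val this.1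
        have h2 := congrArg Subtype.val this.2
        simp [sub_eq_zero] at h1 h2
        rw [h1, h2]; rfl
    · refine ⟨{p | G p.1 ≠ G p.2}, mem_nhdsWithin_of_mem_nhds (IsOpen.mem_nhds ?_ hxy), ?_⟩
      · exact isOpen_ne_fun (hsm.continuous.comp continuous_fst) (hsm.continuous.comp continuous_snd)
      · convert Set.finite_empty
        rw [Set.eq_empty_iff_forall_notMem]
        rintro p ⟨⟨-, -, h1⟩, h2⟩
        exact h2 h1
  exact key.subset fun p hp => ⟨hp, hp.1⟩

/-- The double point set. -/
def dbl (K : Geometry.SimplicialComplex ℝ (EuclideanSpace ℝ (Fin n)))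
    (G : EuclideanSpace ℝ (Fin n) → EuclideanSpace ℝ (Fin d)) : Set (EuclideanSpace ℝ (Fin n)) :=
  {x | x ∈ K.space ∧ ∃ y ∈ K.space, x ≠ y ∧ G x = G y}

theorem GenericMap.finite_dbl (hG : GenericMap K G) (hK : K.faces.Finite) : (dbl K G).Finite := by
  have h : (⋃ s ∈ K.faces, ⋃ t ∈ K.faces, Prod.fst ''
     {p : EuclideanSpace ℝ (Fin n) × EuclideanSpace ℝ (Fin n) |
      p ∈ convexHull ℝ (s : Set (EuclideanSpace ℝ (Fin n))) ×ˢ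
        convexHull ℝ (t : Set (EuclideanSpace ℝ (Fin n))) ∧
      p.1 ≠ p.2 ∧ G p.1 = G p.2}).Finite :=
    hK.biUnion fun s hs => hK.biUnion fun t ht => (hG.finite_pair hs ht).image _
  refine h.subset ?_
  rintro x ⟨hx, y, hy, hne, he⟩
  obtain ⟨s, hs, hxs⟩ := SimplicialComplex.mem_space_iff.1 hx
  obtain ⟨t, ht, hyt⟩ := SimplicialComplex.mem_space_iff.1 hy
  simp only [mem_iUnion]
  exact ⟨s, hs, t, ht, (x, y), ⟨⟨hxs, hyt⟩, hne, he⟩, rfl⟩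

end Fin

open Set MeasureTheory Topology Module


section Assign
set_option linter.unusedSectionVars false
open Geometry

variable {n d : ℕ} {K : Geometry.SimplicialComplex ℝ (EuclideanSpace ℝ (Fin n))}
  {G : EuclideanSpace ℝ (Fin n) → EuclideanSpace ℝ (Fin d)}

/-- `v` is a vertex of every face containing `x`. -/
def InStar (K : Geometry.SimplicialComplex ℝ (EuclideanSpace ℝ (Fin n)))
    (v x : EuclideanSpace ℝ (Fin n)) : Prop :=
  ∀ s ∈ K.faces, x ∈ convexHull ℝ (s : Set (EuclideanSpace ℝ (Fin n))) → v ∈ s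

theorem InStar.notMem {v x : EuclideanSpace ℝ (Fin n)} (h : InStar K v x) (hx : x ∈ K.space)
    {s : Finset (EuclideanSpace ℝ (Fin n))} (hs : s ∈ K.faces) (hv : v ∉ s)
    {l : ℝ} (hl : l ∈ Icc (0 : ℝ) 1) :
    v + l • (x - v) ∉ convexHull ℝ (s : Set (EuclideanSpace ℝ (Fin n))) := by
  classical
  intro hP
  obtain ⟨t, ht, hxt⟩ := SimplicialComplex.mem_space_iff.1 hx
  have hvt := h t ht hxt
  have hx' : x ∉ convexHull ℝ ((t.erase v : Finset _) : Set (EuclideanSpace ℝ (Fin n))) := by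
    intro hx'
    have hne : (t.erase v).Nonempty := by
      rw [← Finset.coe_nonempty]; exact convexHull_nonempty_iff.1 ⟨x, hx'⟩
    have := h _ (K.down_closed ht (Finset.erase_subset v t) hne) hx'
    simp at this
  have hPt : v + l • (x - v) ∈ convexHull ℝ (t : Set (EuclideanSpace ℝ (Fin n))) := by
    have := (convex_convexHull ℝ (t : Set (EuclideanSpace ℝ (Fin n))))
      (subset_convexHull ℝ _ hvt) hxt (sub_nonneg.2 hl.2) hl.1 (by ring)
    convert this using 1
    module
  have h2 := (face_inter hs ht hP hPt).2
  apply star_notMem (K.indep ht) hvt hxt hx' hl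
  apply convexHull_subset_affineSpan
  refine convexHull_mono ?_ h2
  rw [Finset.coe_subset]
  intro y hy
  rw [Finset.mem_inter] at hy
  rw [Finset.mem_erase]
  exact ⟨fun h => hv (h ▸ hy.1), hy.2⟩

theorem inStar_self {v : EuclideanSpace ℝ (Fin n)} (hv : v ∈ K.vertices) : InStar K v v :=
  fun _ hs h => (SimplicialComplex.vertex_mem_convexHull_iff hv hs).1 h

theorem InStar.vertex {v x : EuclideanSpace ℝ (Fin n)} (h : InStar K v x) (hx : x ∈ K.space) :
    v ∈ K.vertices := by
  obtain ⟨t, ht, hxt⟩ := SimplicialComplex.mem_space_iff.1 hx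
  rw [SimplicialComplex.vertices_eq]
  exact mem_biUnion ht (h t ht hxt)

theorem exists_vert (hG : GenericMap K G) (z : EuclideanSpace ℝ (Fin d)) :
    ∃ v, ∀ x ∈ dbl K G, G x = z → InStar K v x := by
  classical
  by_cases h : ∃ x ∈ dbl K G, G x = z
  · obtain ⟨x, ⟨hx, y, hy, hne, he⟩, rfl⟩ := h
    obtain ⟨s, hs, hxs, hsmin⟩ := supp_exists hx
    obtain ⟨t, ht, hyt, htmin⟩ := supp_exists hy
    have hnd : ¬ Disjoint s t := fun hd => hG.almost s hs t ht hd x hxs y hyt he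
    rw [Finset.not_disjoint_iff] at hnd
    obtain ⟨v, hvs, hvt⟩ := hnd
    refine ⟨v, fun x' hx' he' => ?_⟩
    by_cases h1 : x' = x
    · subst h1; exact fun r hr hxr => hsmin r hr hxr hvs
    by_cases h2 : x' = y
    · subst h2; exact fun r hr hxr => htmin r hr hxr hvt
    exact absurd ⟨he, he'.trans he⟩ (hG.triple x hx y hy x' hx'.1 hne (Ne.symm h1) h2)
  · exact ⟨0, fun x hx he => absurd ⟨x, hx, he⟩ h⟩

/-- An assignment of finite sets to the vertices. -/
structure Assign (K : Geometry.SimplicialComplex ℝ (EuclideanSpace ℝ (Fin n)))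
    (G : EuclideanSpace ℝ (Fin n) → EuclideanSpace ℝ (Fin d))
    (A : EuclideanSpace ℝ (Fin n) → Set (EuclideanSpace ℝ (Fin n))) : Prop where
  self : ∀ v ∈ K.vertices, v ∈ A v
  fin : ∀ v ∈ K.vertices, (A v).Finite
  space : ∀ v ∈ K.vertices, A v ⊆ K.space
  star : ∀ v ∈ K.vertices, ∀ x ∈ A v, InStar K v x
  disj : ∀ v ∈ K.vertices, ∀ w ∈ K.vertices, v ≠ w → ∀ x ∈ A v, ∀ y ∈ A w,
    ∀ l ∈ Icc (0 : ℝ) 1, ∀ k ∈ Icc (0 : ℝ) 1, v + l • (x - v) ≠ w + k • (y - w)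
  dbl : ∀ x ∈ K.space, ∀ y ∈ K.space, x ≠ y → G x = G y →
    ∃ v ∈ K.vertices, x ∈ A v ∧ y ∈ A v

theorem exists_assign (hG : GenericMap K G) (hK : K.faces.Finite) : ∃ A, Assign K G A := by
  classical
  choose vert hvert using exists_vert hG
  have hvv : ∀ x ∈ _root_.dbl K G, InStar K (vert (G x)) x := fun x hx => hvert _ x hx rfl
  refine ⟨fun v => insert v {x | x ∈ _root_.dbl K G ∧ vert (G x) = v}, ?_, ?_, ?_, ?_, ?_, ?_⟩
  · intro v _; exact mem_insert _ _
  · intro v _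
    exact ((hG.finite_dbl hK).subset (fun x hx => hx.1)).insert v
  · rintro v hv x (rfl | hx)
    · exact SimplicialComplex.vertices_subset_space hv
    · exact hx.1.1
  · rintro v hv x (rfl | ⟨hx, rfl⟩)
    · exact inStar_self hv
    · exact hvv x hx
  · intro v hv w hw hvw x hx y hy l hl k hk hP
    have hx0 : InStar K v x ∧ x ∈ K.space := by
      rcases hx with rfl | ⟨hx, rfl⟩
      · exact ⟨inStar_self hv, SimplicialComplex.vertices_subset_space hv⟩
      · exact ⟨hvv x hx, hx.1⟩
    have hy0 : InStar K w y ∧ y ∈ K.space := by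
      rcases hy with rfl | ⟨hy, rfl⟩
      · exact ⟨inStar_self hw, SimplicialComplex.vertices_subset_space hw⟩
      · exact ⟨hvv y hy, hy.1⟩
    have noV : v + l • (x - v) ≠ v := by
      intro h
      apply hy0.1.notMem hy0.2 (s := {v}) hv (by simpa using hvw.symm) hk
      rw [← hP, h]; simp
    have noW : w + k • (y - w) ≠ w := by
      intro h
      apply hx0.1.notMem hx0.2 (s := {w}) hw (by simpa using hvw) hl
      rw [hP, h]; simp
    rcases hx with rfl | ⟨hx, hxv⟩
    · simp at noV
    rcases hy with rfl | ⟨hy, hyw⟩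
    · simp at noW
    have hk0 : k ≠ 0 := by rintro rfl; simp at noW
    obtain ⟨-, x', hx', hxx', hGx⟩ := hx
    obtain ⟨-, y', hy', hyy', hGy⟩ := hy
    have hGne : G x ≠ G y := by
      intro h; apply hvw; rw [← hxv, ← hyw, h]
    refine hG.seg v hv w hw x hx0.2 x' hx' y' hy' (k⁻¹ * (1 - l)) (k⁻¹ * l) y ?_ hxx' ?_ ?_ ?_ hyy'
      ⟨hGx, hGy⟩
    · have h1 : y = w + k⁻¹ • (k • (y - w)) := by
        rw [smul_smul, inv_mul_cancel₀ hk0]; simp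
      have h2 : k • (y - w) = v + l • (x - v) - w := by rw [hP]; abel
      rw [h2] at h1
      rw [h1]
      module
    · rintro rfl; exact hGne rfl
    · rintro rfl; exact hGne hGy.symm
    · rintro rfl; exact hGne hGx
  · intro x hx y hy hne he
    have hxd : x ∈ _root_.dbl K G := ⟨hx, y, hy, hne, he⟩
    have hyd : y ∈ _root_.dbl K G := ⟨hy, x, hx, hne.symm, he.symm⟩
    exact ⟨vert (G x), (hvv x hxd).vertex hx, Or.inr ⟨hxd, rfl⟩, Or.inr ⟨hyd, by rw [he]⟩⟩

end Assign

open Set MeasureTheory Topology Module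


section Cone
set_option linter.unusedSectionVars false
open Geometry

variable {n d : ℕ} {K : Geometry.SimplicialComplex ℝ (EuclideanSpace ℝ (Fin n))}
  {G : EuclideanSpace ℝ (Fin n) → EuclideanSpace ℝ (Fin d)}

theorem cone_one {ι : Type} [Fintype ι] (hG : ContDiff ℝ 1 G) (i : ι)
    (v x p : EuclideanSpace ℝ (Fin n)) (F : Submodule ℝ (EuclideanSpace ℝ (Fin n)))
    (hF : finrank ℝ F + 2 < d) :
    ∀ᵐ c : ι → EuclideanSpace ℝ (Fin d), ∀ a s : ℝ, s ≠ 1 → ∀ u ∈ F,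
      c i + s • (G (v + a • (x - v)) - c i) ≠ G (p + u) := by
  have h := paramTrans_lt (volume : Measure (ι → EuclideanSpace ℝ (Fin d)))
    (X := F × ℝ × ℝ) (E := EuclideanSpace ℝ (Fin d)) (by simpa using hF)
    (fun q => q.2.2 • G (v + q.2.1 • (x - v)) - G (p + (q.1 : EuclideanSpace ℝ (Fin n))))
    (fun q => (1 - q.2.2) • ContinuousLinearMap.proj i)
    (by
      have h1 : ContDiff ℝ 1 fun q : F × ℝ × ℝ => (q.1 : EuclideanSpace ℝ (Fin n)) :=
        F.subtypeL.contDiff.comp contDiff_fst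
      have h2 : ContDiff ℝ 1 fun q : F × ℝ × ℝ => G (v + q.2.1 • (x - v)) :=
        hG.comp (by fun_prop)
      have h3 : ContDiff ℝ 1 fun q : F × ℝ × ℝ => G (p + (q.1 : EuclideanSpace ℝ (Fin n))) :=
        hG.comp (contDiff_const.add h1)
      have h4 : ContDiff ℝ 1 fun q : F × ℝ × ℝ => q.2.2 := by fun_prop
      exact (h4.smul h2).sub h3)
    (by fun_prop) {q | q.2.2 ≠ 1} (by
      intro q hq e
      have : 1 - q.2.2 ≠ 0 := sub_ne_zero.2 (Ne.symm hq)
      refine ⟨fun _ => (1 - q.2.2)⁻¹ • e, ?_⟩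
      simp [smul_smul, this])
  filter_upwards [h] with c hc a s hs u hu heq
  apply hc (⟨u, hu⟩, a, s) hs
  simp only [ContinuousLinearMap.smul_apply, ContinuousLinearMap.proj_apply]
  rw [← heq]
  module

theorem cone_two {ι : Type} [Fintype ι] [DecidableEq ι] (hG : ContDiff ℝ 1 G) (i j : ι)
    (hij : i ≠ j) (v x w y : EuclideanSpace ℝ (Fin n)) (hd : 4 < d) :
    ∀ᵐ c : ι → EuclideanSpace ℝ (Fin d), ∀ a s b r : ℝ, s ≠ 1 → 
      c i + s • (G (v + a • (x - v)) - c i) ≠ c j + r • (G (w + b • (y - w)) - c j) := by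
  have h := paramTrans_lt (volume : Measure (ι → EuclideanSpace ℝ (Fin d)))
    (X := ℝ × ℝ × ℝ × ℝ) (E := EuclideanSpace ℝ (Fin d)) (by simpa using hd)
    (fun q => q.2.1 • G (v + q.1 • (x - v)) - q.2.2.2 • G (w + q.2.2.1 • (y - w)))
    (fun q => (1 - q.2.1) • ContinuousLinearMap.proj i -
      (1 - q.2.2.2) • ContinuousLinearMap.proj j)
    (by
      have h2 : ContDiff ℝ 1 fun q : ℝ × ℝ × ℝ × ℝ => G (v + q.1 • (x - v)) :=
        hG.comp (by fun_prop)
      have h3 : ContDiff ℝ 1 fun q : ℝ × ℝ × ℝ × ℝ => G (w + q.2.2.1 • (y - w)) :=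
        hG.comp (by fun_prop)
      have h4 : ContDiff ℝ 1 fun q : ℝ × ℝ × ℝ × ℝ => q.2.1 := by fun_prop
      have h5 : ContDiff ℝ 1 fun q : ℝ × ℝ × ℝ × ℝ => q.2.2.2 := by fun_prop
      exact (h4.smul h2).sub (h5.smul h3))
    (by fun_prop) {q | q.2.1 ≠ 1} (by
      intro q hq e
      have : 1 - q.2.1 ≠ 0 := sub_ne_zero.2 (Ne.symm hq)
      refine ⟨Pi.single i ((1 - q.2.1)⁻¹ • e), ?_⟩
      simp [smul_smul, this, hij.symm])
  filter_upwards [h] with c hc a s b r hs heq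
  apply hc (a, s, b, r) hs
  simp only [ContinuousLinearMap.smul_apply, ContinuousLinearMap.proj_apply,
    ContinuousLinearMap.sub_apply]
  have : c i + s • (G (v + a • (x - v)) - c i) - (c j + r • (G (w + b • (y - w)) - c j)) = 0 :=
    sub_eq_zero.2 heq
  rw [← this]
  module

/-- Union of segments. -/
def trees (A : EuclideanSpace ℝ (Fin n) → Set (EuclideanSpace ℝ (Fin n)))
    (v : EuclideanSpace ℝ (Fin n)) : Set (EuclideanSpace ℝ (Fin n)) :=
  {t | ∃ x ∈ A v, ∃ l ∈ Icc (0 : ℝ) 1, t = v + l • (x - v)}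

/-- Cone over the image of a set. -/
def coneOn {V E : Type*} [AddCommGroup E] [Module ℝ E] (G : V → E) (T : Set V) (c : E) : Set E :=
  {z | ∃ t ∈ T, ∃ s ∈ Icc (0 : ℝ) 1, z = c + s • (G t - c)}

theorem coneOn_star {V E : Type*} [AddCommGroup E] [Module ℝ E] (G : V → E) (T : Set V) (c : E) :
    StarConvex ℝ c (coneOn G T c) := by
  rintro _ ⟨t, ht, s, hs, rfl⟩ a b ha hb hab
  refine ⟨t, ht, b * s, ⟨mul_nonneg hb hs.1, ?_⟩, ?_⟩
  · have : b ≤ 1 := by linarith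
    nlinarith [hs.1, hs.2]
  · have : a = 1 - b := by linarith
    subst this; module

theorem coneOn_compact {V E : Type*} [TopologicalSpace V] [NormedAddCommGroup E] [NormedSpace ℝ E]
    {G : V → E} {T : Set V} (hT : IsCompact T) (hG : ContinuousOn G T) (c : E) :
    IsCompact (coneOn G T c) := by
  have : coneOn G T c = (fun q : V × ℝ => c + q.2 • (G q.1 - c)) '' (T ×ˢ Icc (0 : ℝ) 1) := by
    ext z
    constructor
    · rintro ⟨t, ht, s, hs, rfl⟩; exact ⟨(t, s), ⟨ht, hs⟩, rfl⟩
    · rintro ⟨⟨t, s⟩, ⟨ht, hs⟩, rfl⟩; exact ⟨t, ht, s, hs, rfl⟩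
  rw [this]
  refine (hT.prod isCompact_Icc).image_of_continuousOn ?_
  have h1 : ContinuousOn (fun q : V × ℝ => G q.1) (T ×ˢ Icc (0 : ℝ) 1) :=
    hG.comp continuousOn_fst (fun q hq => hq.1)
  exact continuousOn_const.add (continuousOn_snd.smul (h1.sub continuousOn_const))

theorem coneOn_apex {V E : Type*} [AddCommGroup E] [Module ℝ E] (G : V → E) {T : Set V} (c : E)
    (hT : T.Nonempty) : c ∈ coneOn G T c := by
  obtain ⟨t, ht⟩ := hT
  exact ⟨t, ht, 0, by simp, by simp⟩

theorem coneOn_base {V E : Type*} [AddCommGroup E] [Module ℝ E] (G : V → E) {T : Set V} (c : E)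
    {t : V} (ht : t ∈ T) : G t ∈ coneOn G T c := 
  ⟨t, ht, 1, by simp, by simp⟩

theorem trees_eq (A : EuclideanSpace ℝ (Fin n) → Set (EuclideanSpace ℝ (Fin n)))
    (v : EuclideanSpace ℝ (Fin n)) : trees A v = coneOn id (A v) v := rfl

theorem mem_trees {A : EuclideanSpace ℝ (Fin n) → Set (EuclideanSpace ℝ (Fin n))}
    {v x : EuclideanSpace ℝ (Fin n)} (h : x ∈ A v) : x ∈ trees A v :=
  coneOn_base id v h

variable {A : EuclideanSpace ℝ (Fin n) → Set (EuclideanSpace ℝ (Fin n))}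

theorem trees_space (hA : Assign K G A) {v : EuclideanSpace ℝ (Fin n)} (hv : v ∈ K.vertices) :
    trees A v ⊆ K.space := by
  rintro _ ⟨x, hx, l, hl, rfl⟩
  obtain ⟨t, ht, hxt⟩ := SimplicialComplex.mem_space_iff.1 (hA.space v hv hx)
  have hvt := hA.star v hv x hx t ht hxt
  apply SimplicialComplex.convexHull_subset_space ht
  have := (convex_convexHull ℝ (t : Set (EuclideanSpace ℝ (Fin n))))
      (subset_convexHull ℝ _ hvt) hxt (sub_nonneg.2 hl.2) hl.1 (by ring)
  convert this using 1
  module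

theorem trees_disj (hA : Assign K G A) {v w x : EuclideanSpace ℝ (Fin n)} (hv : v ∈ K.vertices)
    (hw : w ∈ K.vertices) (h1 : x ∈ trees A v) (h2 : x ∈ trees A w) : v = w := by
  obtain ⟨y, hy, l, hl, rfl⟩ := h1
  obtain ⟨z, hz, k, hk, h⟩ := h2
  by_contra hne
  exact hA.disj v hv w hw hne y hy z hz l hl k hk h

theorem trees_face (hA : Assign K G A) {v : EuclideanSpace ℝ (Fin n)} (hv : v ∈ K.vertices)
    {s : Finset (EuclideanSpace ℝ (Fin n))} (hs : s ∈ K.faces) (hvs : v ∉ s) :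
    Disjoint (trees A v) (convexHull ℝ (s : Set (EuclideanSpace ℝ (Fin n)))) := by
  rw [Set.disjoint_left]
  rintro _ ⟨x, hx, l, hl, rfl⟩
  exact (hA.star v hv x hx).notMem (hA.space v hv hx) hs hvs hl

theorem trees_dbl (hA : Assign K G A) {v x y : EuclideanSpace ℝ (Fin n)} (hv : v ∈ K.vertices)
    (hx : x ∈ trees A v) (hy : y ∈ K.space) (h : G x = G y) : y ∈ trees A v := by
  by_cases hxy : x = y
  · exact hxy ▸ hx
  · obtain ⟨u, hu, h1, h2⟩ := hA.dbl x (trees_space hA hv hx) y hy hxy h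
    have := trees_disj hA hv hu hx (mem_trees h1)
    subst this
    exact mem_trees h2

theorem exists_apex {m : ℕ} (hm : 3 ≤ m)
    {G : EuclideanSpace ℝ (Fin n) → EuclideanSpace ℝ (Fin (2 * m))}
    (hK : K.faces.Finite) (hdim : ∀ s ∈ K.faces, s.card ≤ m + 1) (hG : ContDiff ℝ 1 G)
    (hA : Assign K G A) :
    ∃ c : K.vertices → EuclideanSpace ℝ (Fin (2 * m)),
      (∀ v : K.vertices, ∀ x ∈ K.space, G x ∈ coneOn G (trees A v) (c v) → x ∈ trees A v) ∧
      (∀ v w : K.vertices, v ≠ w →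
        Disjoint (coneOn G (trees A v) (c v)) (coneOn G (trees A w) (c w))) := by
  classical
  have hV := vertices_finite hK
  haveI : Fintype K.vertices := hV.fintype
  have a1 : ∀ᵐ c : K.vertices → EuclideanSpace ℝ (Fin (2 * m)), ∀ v : K.vertices,
      ∀ x ∈ A v, ∀ σ ∈ K.faces, ∀ a s : ℝ, s ≠ 1 →
      ∀ y ∈ convexHull ℝ (σ : Set (EuclideanSpace ℝ (Fin n))),
      c v + s • (G (v + a • (x - v)) - c v) ≠ G y := by
    rw [ae_all_iff]; intro v
    rw [ae_ball_iff (hA.fin v v.2).countable]; intro x hx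
    rw [ae_ball_iff hK.countable]; intro σ hσ
    obtain ⟨p, hp⟩ := SimplicialComplex.nonempty_of_mem_faces hσ
    have hp' := subset_convexHull ℝ (σ : Set (EuclideanSpace ℝ (Fin n))) hp
    filter_upwards [cone_one hG v (v : EuclideanSpace ℝ (Fin n)) x p
      (vectorSpan ℝ (σ : Set (EuclideanSpace ℝ (Fin n))))
      (by have := finrank_face (hdim σ hσ); omega)] with c hc a s hs y hy
    have := hc a s hs (y - p) (sub_mem_face hy hp')
    simpa only [add_sub_cancel] using this
  have a2 : ∀ᵐ c : K.vertices → EuclideanSpace ℝ (Fin (2 * m)), ∀ v w : K.vertices,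
      v ≠ w → ∀ x ∈ A v, ∀ y ∈ A w, ∀ a s b r : ℝ, s ≠ 1 →
      c v + s • (G (v + a • (x - v)) - c v) ≠ c w + r • (G (w + b • (y - w)) - c w) := by
    rw [ae_all_iff]; intro v
    rw [ae_all_iff]; intro w
    by_cases hvw : v = w
    · exact Filter.Eventually.of_forall fun c h => absurd hvw h
    have : ∀ᵐ c : K.vertices → EuclideanSpace ℝ (Fin (2 * m)), 
       ∀ x ∈ A v, ∀ y ∈ A w, ∀ a s b r : ℝ, s ≠ 1 →
      c v + s • (G (v + a • (x - v)) - c v) ≠ c w + r • (G (w + b • (y - w)) - c w) := by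
      rw [ae_ball_iff (hA.fin v v.2).countable]; intro x hx
      rw [ae_ball_iff (hA.fin w w.2).countable]; intro y hy
      exact cone_two hG v w hvw v x w y (by omega)
    filter_upwards [this] with c hc _
    exact hc
  obtain ⟨c, h1, h2⟩ := (a1.and a2).exists
  have key : ∀ v : K.vertices, ∀ x ∈ K.space, G x ∈ coneOn G (trees A v) (c v) →
      x ∈ trees A v := by
    rintro v x hx ⟨t, ht, s, hs, h⟩
    by_cases hs1 : s = 1
    · subst hs1
      have : G t = G x := by rw [h]; module
      exact trees_dbl hA v.2 ht hx this
    · obtain ⟨z, hz, l, hl, rfl⟩ := ht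
      obtain ⟨σ, hσ, hxσ⟩ := SimplicialComplex.mem_space_iff.1 hx
      exact absurd h.symm (h1 v z hz σ hσ l s hs1 x hxσ)
  refine ⟨c, key, ?_⟩
  intro v w hvw
  rw [Set.disjoint_left]
  rintro q ⟨t, ht, s, hs, hq⟩ hq'
  by_cases hs1 : s = 1
  · subst hs1
    have : q = G t := by rw [hq]; module
    rw [this] at hq'
    have := key w t (trees_space hA v.2 ht) hq'
    exact hvw (Subtype.ext (trees_disj hA v.2 w.2 ht this))
  · obtain ⟨t', ht', r, hr, hq'⟩ := hq'
    obtain ⟨z, hz, l, hl, rfl⟩ := ht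
    obtain ⟨z', hz', l', hl', rfl⟩ := ht'
    exact h2 v w hvw z hz z' hz' l s l' r hs1 (hq.symm.trans hq')

end Cone

open Set MeasureTheory Topology Module


section Final
set_option linter.unusedSectionVars false
open Geometry

variable {n d : ℕ} {K : Geometry.SimplicialComplex ℝ (EuclideanSpace ℝ (Fin n))}
  {A : EuclideanSpace ℝ (Fin n) → Set (EuclideanSpace ℝ (Fin n))} {ε : ℝ}

theorem hull_ray {s : Finset (EuclideanSpace ℝ (Fin n))} {v z : EuclideanSpace ℝ (Fin n)}
    (hv : v ∈ s) (hz : z ∈ convexHull ℝ (s : Set (EuclideanSpace ℝ (Fin n)))) {l : ℝ}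
    (hl : l ∈ Icc (0 : ℝ) 1) :
    v + l • (z - v) ∈ convexHull ℝ (s : Set (EuclideanSpace ℝ (Fin n))) := by
  have := (convex_convexHull ℝ (s : Set (EuclideanSpace ℝ (Fin n))))
      (subset_convexHull ℝ _ hv) hz (sub_nonneg.2 hl.2) hl.1 (by ring)
  convert this using 1
  module

theorem collapse_maps [Fintype K.vertices]
    (h : StarFam (fun v : K.vertices => trees A v) (fun v => (v : EuclideanSpace ℝ (Fin n))) ε)
    (hf : ∀ v : K.vertices, ∀ s ∈ K.faces, (v : EuclideanSpace ℝ (Fin n)) ∉ s → ∀ x,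
      Metric.infDist x (trees A v) < ε →
      ε ≤ Metric.infDist x (convexHull ℝ (s : Set (EuclideanSpace ℝ (Fin n))))) :
    MapsTo (collapse (fun v : K.vertices => trees A v) (fun v => (v : EuclideanSpace ℝ (Fin n))) ε)
      K.space K.space := by
  intro z hz
  by_cases hoff : ∀ v : K.vertices, ε ≤ Metric.infDist z (trees A v)
  · rw [h.off hoff]; exact hz
  · push Not at hoff
    obtain ⟨v, hv⟩ := hoff
    obtain ⟨s, hs, hzs⟩ := SimplicialComplex.mem_space_iff.1 hz
    have hvs : (v : EuclideanSpace ℝ (Fin n)) ∈ s := by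
      by_contra hvs
      have := hf v s hs hvs z hv
      rw [Metric.infDist_zero_of_mem hzs] at this
      exact absurd h.pos (not_lt.2 this)
    rw [h.on hv]
    apply SimplicialComplex.convexHull_subset_space hs
    apply hull_ray hvs hzs
    exact ⟨div_nonneg Metric.infDist_nonneg h.pos.le, (div_le_one h.pos).2 hv.le⟩

theorem collapse_surj [Fintype K.vertices]
    (h : StarFam (fun v : K.vertices => trees A v) (fun v => (v : EuclideanSpace ℝ (Fin n))) ε)
    (hf : ∀ v : K.vertices, ∀ s ∈ K.faces, (v : EuclideanSpace ℝ (Fin n)) ∉ s → ∀ x,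
      Metric.infDist x (trees A v) < ε →
      ε ≤ Metric.infDist x (convexHull ℝ (s : Set (EuclideanSpace ℝ (Fin n))))) :
    SurjOn (collapse (fun v : K.vertices => trees A v) (fun v => (v : EuclideanSpace ℝ (Fin n))) ε)
      K.space K.space := by
  classical
  intro z hz
  by_cases hoff : ∀ v : K.vertices, ε ≤ Metric.infDist z (trees A v)
  · exact ⟨z, hz, h.off hoff⟩
  push Not at hoff
  obtain ⟨v, hv⟩ := hoff
  obtain ⟨s, hs, hzs⟩ := SimplicialComplex.mem_space_iff.1 hz
  have hvs : (v : EuclideanSpace ℝ (Fin n)) ∈ s := by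
    by_contra hvs
    have := hf v s hs hvs z hv
    rw [Metric.infDist_zero_of_mem hzs] at this
    exact absurd h.pos (not_lt.2 this)
  rcases cone_decomp hvs hzs with rfl | ⟨p, hp, b, hb, hzb⟩
  · exact ⟨v, hz, h.on_mem (h.mem v)⟩
  have hne : (s.erase (v : EuclideanSpace ℝ (Fin n))).Nonempty := by
    rw [← Finset.coe_nonempty]; exact convexHull_nonempty_iff.1 ⟨p, hp⟩
  have hps : p ∈ convexHull ℝ (s : Set (EuclideanSpace ℝ (Fin n))) :=
    convexHull_mono (Finset.coe_subset.2 (Finset.erase_subset _ _)) hp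
  have hpd : ε ≤ Metric.infDist p (trees A v) := by
    by_contra hpd
    have := hf v _ (K.down_closed hs (Finset.erase_subset _ s) hne) (by simp) p (not_le.1 hpd)
    rw [Metric.infDist_zero_of_mem hp] at this
    exact absurd h.pos (not_lt.2 this)
  set φ : ℝ → ℝ := fun β =>
    min 1 (Metric.infDist ((v : EuclideanSpace ℝ (Fin n)) + β • (p - v)) (trees A v) / ε) * β with hφ
  have hcont : Continuous φ := by
    have h1 : Continuous fun β : ℝ =>
        Metric.infDist ((v : EuclideanSpace ℝ (Fin n)) + β • (p - v)) (trees A v) :=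
      (Metric.continuous_infDist_pt _).comp (by fun_prop)
    exact (continuous_const.min (h1.div_const ε)).mul continuous_id
  have hb1 : φ b ≤ b := by
    have : min 1 (Metric.infDist ((v : EuclideanSpace ℝ (Fin n)) + b • (p - v)) (trees A v) / ε) ≤ 1 :=
      min_le_left _ _
    simp only [hφ]
    nlinarith [hb.1]
  have h11 : φ 1 = 1 := by
    simp only [hφ, one_smul, add_sub_cancel, mul_one]
    exact min_eq_left ((one_le_div h.pos).2 hpd)
  obtain ⟨β, hβ, hβb⟩ := intermediate_value_Icc hb.2 hcont.continuousOn
    (show b ∈ Icc (φ b) (φ 1) from ⟨hb1, hb.2.trans h11.ge⟩)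
  have hβ01 : β ∈ Icc (0 : ℝ) 1 := ⟨hb.1.trans hβ.1, hβ.2⟩
  have hmem : (v : EuclideanSpace ℝ (Fin n)) + β • (p - v) ∈ K.space :=
    SimplicialComplex.convexHull_subset_space hs (hull_ray hvs hps hβ01)
  by_cases hin : Metric.infDist ((v : EuclideanSpace ℝ (Fin n)) + β • (p - v)) (trees A v) < ε
  · refine ⟨_, hmem, ?_⟩
    rw [h.on hin, hzb]
    have h1 := (div_le_one h.pos).2 hin.le
    simp only [hφ] at hβb
    rw [min_eq_right h1] at hβb
    rw [add_sub_cancel_left, smul_smul, hβb]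
  · exfalso
    have h1 := (one_le_div h.pos).2 (not_lt.1 hin)
    simp only [hφ] at hβb
    rw [min_eq_left h1, one_mul] at hβb
    subst hβb
    rw [← hzb] at hin
    exact hin hv

theorem final_embedding {m : ℕ} (hm : 3 ≤ m) (hK : K.faces.Finite)
    (hdim : ∀ s ∈ K.faces, s.card ≤ m + 1)
    {G : EuclideanSpace ℝ (Fin n) → EuclideanSpace ℝ (Fin (2 * m))}
    (hG : ContDiff ℝ 1 G) (hA : Assign K G A) :
    ∃ g : EuclideanSpace ℝ (Fin n) → EuclideanSpace ℝ (Fin (2 * m)),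
      ContinuousOn g K.space ∧ Set.InjOn g K.space := by
  classical
  obtain ⟨c, hc1, hc2⟩ := exists_apex hm hK hdim hG hA
  haveI : Fintype K.vertices := (vertices_finite hK).fintype
  have hTc : ∀ v : K.vertices, IsCompact (trees A v) := fun v =>
    coneOn_compact (hA.fin v v.2).isCompact continuousOn_id _
  have hTm : ∀ v : K.vertices, (v : EuclideanSpace ℝ (Fin n)) ∈ trees A v := fun v =>
    mem_trees (hA.self v v.2)
  have hTs : ∀ v : K.vertices, StarConvex ℝ (v : EuclideanSpace ℝ (Fin n)) (trees A v) := fun v =>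
    coneOn_star _ _ _
  have hTd : ∀ v w : K.vertices, v ≠ w → Disjoint (trees A v) (trees A w) := by
    intro v w hvw
    rw [Set.disjoint_left]
    intro x h1 h2
    exact hvw (Subtype.ext (trees_disj hA v.2 w.2 h1 h2))
  have e1 := starFam_eventually (D := fun v : K.vertices => trees A v)
    (c := fun v => (v : EuclideanSpace ℝ (Fin n))) hTc hTm hTs hTd
  have e2 : ∀ᶠ ε in 𝓝[>] (0 : ℝ), ∀ v : K.vertices, ∀ s ∈ K.faces,
      (v : EuclideanSpace ℝ (Fin n)) ∉ s → ∀ x, Metric.infDist x (trees A v) < ε →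
      ε ≤ Metric.infDist x (convexHull ℝ (s : Set (EuclideanSpace ℝ (Fin n)))) := by
    rw [Filter.eventually_all]; intro v
    rw [Filter.eventually_all_finite hK]; intro s hs
    by_cases hvs : (v : EuclideanSpace ℝ (Fin n)) ∈ s
    · exact Filter.Eventually.of_forall fun _ h => absurd hvs h
    · filter_upwards [disj_eventually (hTc v) (hull_compact s).isClosed (trees_face hA v.2 hs hvs)
        ⟨_, hTm v⟩ (convexHull_nonempty_iff.2 (Finset.coe_nonempty.2
          (SimplicialComplex.nonempty_of_mem_faces hs)))] with ε h _
      exact h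
  obtain ⟨ε, hS, hf⟩ := (e1.and e2).exists
  obtain ⟨η, hD⟩ := (starFam_eventually (D := fun v : K.vertices => coneOn G (trees A v) (c v))
    (c := c) (fun v => coneOn_compact (hTc v) hG.continuous.continuousOn _)
    (fun v => coneOn_apex _ _ ⟨_, hTm v⟩) (fun v => coneOn_star _ _ _) hc2).exists
  set q := collapse (fun v : K.vertices => trees A v) (fun v => (v : EuclideanSpace ℝ (Fin n))) ε
    with hq
  set h := collapse (fun v : K.vertices => coneOn G (trees A v) (c v)) c η with hh
  have hqm : MapsTo q K.space K.space := collapse_maps hS hf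
  have hqs : SurjOn q K.space K.space := collapse_surj hS hf
  have hqc : Continuous q := collapse_continuous _ _ _
  have hhc : Continuous fun x => h (G x) := (collapse_continuous _ _ _).comp hG.continuous
  have hiff : ∀ x ∈ K.space, ∀ y ∈ K.space, q x = q y ↔ h (G x) = h (G y) := by
    intro x hx y hy
    constructor
    · intro hxy
      rcases hS.inj hxy with rfl | ⟨v, h1, h2⟩
      · rfl
      · rw [hh, hD.on_mem (i := v) (coneOn_base G (c v) h1),
          hD.on_mem (i := v) (coneOn_base G (c v) h2)]
    · intro hxy
      have : x = y ∨ ∃ v : K.vertices, x ∈ trees A v ∧ y ∈ trees A v := by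
        rcases hD.inj hxy with h1 | ⟨v, h1, h2⟩
        · by_cases hne : x = y
          · exact Or.inl hne
          · obtain ⟨v, hv, h2, h3⟩ := hA.dbl x hx y hy hne h1
            exact Or.inr ⟨⟨v, hv⟩, mem_trees h2, mem_trees h3⟩
        · exact Or.inr ⟨v, hc1 v x hx h1, hc1 v y hy h2⟩
      rcases this with rfl | ⟨v, h1, h2⟩
      · rfl
      · rw [hq, hS.on_mem (i := v) h1, hS.on_mem (i := v) h2]
  haveI : CompactSpace K.space := isCompact_iff_compactSpace.1 (space_compact hK)
  have hquot : IsQuotientMap (hqm.restrict q K.space K.space) := by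
    apply Topology.IsQuotientMap.of_surjective_continuous
    · exact (MapsTo.restrict_surjective_iff hqm).2 hqs
    · exact hqc.continuousOn.mapsToRestrict hqm
  have hqs' : ∀ z, ∃ x, z ∈ K.space → x ∈ K.space ∧ q x = z := by
    intro z
    by_cases hz : z ∈ K.space
    · obtain ⟨x, hx, hxz⟩ := hqs hz
      exact ⟨x, fun _ => ⟨hx, hxz⟩⟩
    · exact ⟨z, fun hz' => absurd hz' hz⟩
  choose r hr using hqs'
  have hr1 : ∀ {z}, z ∈ K.space → r z ∈ K.space := fun hz => (hr _ hz).1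
  have hr2 : ∀ {z}, z ∈ K.space → q (r z) = z := fun hz => (hr _ hz).2
  refine ⟨fun z => h (G (r z)), ?_, ?_⟩
  · rw [continuousOn_iff_continuous_restrict, hquot.continuous_iff]
    have : (K.space.domRestrict fun z => h (G (r z))) ∘ hqm.restrict q K.space K.space =
        fun x : K.space => h (G x) := by
      funext x
      have hx := hqm x.2
      exact (hiff _ (hr1 hx) _ x.2).1 (hr2 hx)
    rw [this]
    exact hhc.comp continuous_subtype_val
  · intro z hz w hw hzw
    have := (hiff _ (hr1 hz) _ (hr1 hw)).2 hzw
    rwa [hr2 hz, hr2 hw] at this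

end Final

/-- Van Kampen–Shapiro–Wu, part 2: if a finite geometric simplicial
complex `K` of dimension `m ≥ 3` admits an almost-embedding `|K| → ℝ^{2m}` (a continuous
map without `2`-Tverberg points), then `|K|` topologically embeds in `ℝ^{2m}`, i.e. there
is a continuous injective map `g : |K| → ℝ^{2m}`. -/
theorem statement5 (n m : ℕ) (hm : 3 ≤ m)
    (K : Geometry.SimplicialComplex ℝ (EuclideanSpace ℝ (Fin n)))
    (hK : K.faces.Finite)
    (hdim : HasDimension K m)
    (f : EuclideanSpace ℝ (Fin n) → EuclideanSpace ℝ (Fin (2 * m)))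
    (hf : ContinuousOn f K.space)
    (hT : ¬ HasTverbergPoint K 2 f) :
    ∃ g : EuclideanSpace ℝ (Fin n) → EuclideanSpace ℝ (Fin (2 * m)),
      ContinuousOn g K.space ∧ Set.InjOn g K.space := by
  obtain ⟨G, hG⟩ := exists_generic hm hK hdim.1 hf hT
  obtain ⟨A, hA⟩ := exists_assign hG hK
  exact final_embedding hm hK hdim.1 (hG.smooth.of_le (by norm_num)) hA
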